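/- For each n ≥ 3 there exist two wild Cantor sets X, Y ⊆ ℝⁿ such that X can be ambiently embedded in Y and Y can be ambiently embedded in X, but X and Y are inequivalently embedded: no homeomorphism of ℝⁿ onto itself maps X onto Y. -/

import Mathlib

open Set Topology Metric

noncomputable section

/-- The coordinate line `ℝ × {0}^{n-1}` in `ℝⁿ`. -/
def coordLine (n : ℕ) : Set (EuclideanSpace ℝ (Fin n)) :=
  {x | ∀ i : Fin n, (i : ℕ) ≠ 0 → x i = 0}

/-- The coordinate hyperplane `ℝ^{n-1} × {0}` in `ℝⁿ`. -/
def coordHyperplane (n : ℕ) : Set (EuclideanSpace ℝ (Fin n)) :=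
  {x | ∀ i : Fin n, (i : ℕ) = n - 1 → x i = 0}

/-- `X` can be ambiently embedded in `Y`: some self-homeomorphism of `ℝⁿ` takes `X` into `Y`. -/
def AmbientlyEmbeds {n : ℕ} (X Y : Set (EuclideanSpace ℝ (Fin n))) : Prop :=
  ∃ h : EuclideanSpace ℝ (Fin n) ≃ₜ EuclideanSpace ℝ (Fin n), h '' X ⊆ Y

/-- `X` and `Y` are ambiently incomparable. -/
def AmbientlyIncomparable {n : ℕ} (X Y : Set (EuclideanSpace ℝ (Fin n))) : Prop :=
  ¬ AmbientlyEmbeds X Y ∧ ¬ AmbientlyEmbeds Y X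

/-- `X ⊆ ℝⁿ` is locally hyperplanar at `x ∈ X`. -/
def LocallyHyperplanarAt {n : ℕ} (X : Set (EuclideanSpace ℝ (Fin n)))
    (x : EuclideanSpace ℝ (Fin n)) : Prop :=
  ∃ U ∈ 𝓝 x, ∃ h : U → EuclideanSpace ℝ (Fin n), Topology.IsEmbedding h ∧
    ∀ y : U, (y : EuclideanSpace ℝ (Fin n)) ∈ X → h y ∈ coordHyperplane n

/-- A compact zero-dimensional set `K ⊆ ℝⁿ` is tame if a self-homeomorphism of `ℝⁿ`
moves it into the coordinate line. -/
def TameSet {n : ℕ} (K : Set (EuclideanSpace ℝ (Fin n))) : Prop :=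
  ∃ h : EuclideanSpace ℝ (Fin n) ≃ₜ EuclideanSpace ℝ (Fin n), h '' K ⊆ coordLine n

/-- `K` is locally tame at `x`. -/
def LocallyTameAt {n : ℕ} (K : Set (EuclideanSpace ℝ (Fin n)))
    (x : EuclideanSpace ℝ (Fin n)) : Prop :=
  ∃ U ∈ 𝓝 x, TameSet (K ∩ closure U)

/-- `K` is everywhere wild: locally wild at each of its points. -/
def EverywhereWild {n : ℕ} (K : Set (EuclideanSpace ℝ (Fin n))) : Prop :=
  ∀ x ∈ K, ¬ LocallyTameAt K x

/-- `K` is a Cantor set: homeomorphic to the middle-thirds Cantor set. -/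
def IsCantorSet {X : Type*} [TopologicalSpace X] (K : Set X) : Prop :=
  Nonempty (↥K ≃ₜ ↥cantorSet)

/-- The unit cube `Iⁿ = [0,1]ⁿ` in `ℝⁿ`. -/
def unitCube (n : ℕ) : Set (EuclideanSpace ℝ (Fin n)) :=
  {x | ∀ i, x i ∈ Set.Icc (0 : ℝ) 1}

/-- The open face `(0,1)^{n-1} × {0}` of the unit cube. -/
def openFace (n : ℕ) : Set (EuclideanSpace ℝ (Fin n)) :=
  {x | (∀ i : Fin n, (i : ℕ) < n - 1 → x i ∈ Set.Ioo (0 : ℝ) 1) ∧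
    ∀ i : Fin n, (i : ℕ) = n - 1 → x i = 0}

section Brouwer

open TopologicalSpace

variable {X : Type*} [TopologicalSpace X]

lemma exists_clopen_split [CompactSpace X] [T2Space X] [TotallyDisconnectedSpace X]
    (hperf : ∀ x : X, ¬ IsOpen ({x} : Set X)) (A : Clopens X) (hA : A ≠ ⊥) :
    ∃ S : Clopens X, A ⊓ S ≠ ⊥ ∧ A \ S ≠ ⊥ := by
  obtain ⟨x, hx⟩ : (A : Set X).Nonempty := by
    rw [nonempty_iff_ne_empty]
    exact fun h => hA (SetLike.coe_injective (by simpa using h))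
  obtain ⟨y, hy, hxy⟩ : ∃ y ∈ A, y ≠ x := by
    by_contra! h
    apply hperf x
    have : ({x} : Set X) = A := by
      ext y; exact ⟨fun hy => by rw [mem_singleton_iff.1 hy]; exact hx, fun hy => h y hy⟩
    rw [this]
    exact A.isClopen.isOpen
  obtain ⟨U, hU, hxU, hUy⟩ := compact_exists_isClopen_in_isOpen
    (isOpen_compl_singleton (x := y)) (show x ∈ ({y} : Set X)ᶜ from fun h => hxy h.symm)
  refine ⟨⟨U, hU⟩, fun h => ?_, fun h => ?_⟩
  · have : x ∈ A ⊓ (⟨U, hU⟩ : Clopens X) := ⟨hx, hxU⟩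
    rw [h] at this
    exact this
  · have : y ∈ A \ (⟨U, hU⟩ : Clopens X) := ⟨hy, fun h => hUy h rfl⟩
    rw [h] at this
    exact this

/-- The clopen set obtained by following the branch `β` of the binary splitting `S`. -/
def splitBranch (S : ℕ → Clopens X → Clopens X) (β : ℕ → Bool) : ℕ → Clopens X
  | 0 => ⊤
  | n + 1 => if β n then splitBranch S β n ⊓ S n (splitBranch S β n)
      else splitBranch S β n \ S n (splitBranch S β n)

lemma splitBranch_congr (S : ℕ → Clopens X → Clopens X) {β β' : ℕ → Bool} :
    ∀ n, (∀ i < n, β i = β' i) → splitBranch S β n = splitBranch S β' n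
  | 0, _ => rfl
  | n + 1, h => by
    simp only [splitBranch, splitBranch_congr S n fun i hi => h i (by omega), h n (by omega)]

lemma splitBranch_antitone (S : ℕ → Clopens X → Clopens X) (β : ℕ → Bool) :
    Antitone (splitBranch S β) := by
  refine antitone_nat_of_succ_le fun n => ?_
  simp only [splitBranch]
  split_ifs
  exacts [inf_le_left, sdiff_le]

theorem nonempty_homeomorph_natBool_of_perfect [CompactSpace X] [T2Space X]
    [TotallyDisconnectedSpace X] [SecondCountableTopology X] [Nonempty X]
    (hperf : ∀ x : X, ¬ IsOpen ({x} : Set X)) : Nonempty (X ≃ₜ (ℕ → Bool)) := by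
  classical
  have : Countable (Clopens X) := Clopens.countable_iff_secondCountable.2 inferInstance
  obtain ⟨C, hC⟩ := exists_surjective_nat (Clopens X)
  have hS : ∀ (n : ℕ) (A : Clopens X), ∃ S : Clopens X,
      (A ≠ ⊥ → A ⊓ S ≠ ⊥ ∧ A \ S ≠ ⊥) ∧ (A ⊓ S ≤ C n ∨ A ⊓ S ≤ (C n)ᶜ) ∧
        (A \ S ≤ C n ∨ A \ S ≤ (C n)ᶜ) := by
    intro n A
    by_cases hA : A = ⊥
    · exact ⟨⊥, by simp [hA]⟩
    by_cases h : A ⊓ C n ≠ ⊥ ∧ A \ C n ≠ ⊥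
    · exact ⟨C n, fun _ => h, Or.inl inf_le_right, Or.inr fun x hx => hx.2⟩
    obtain ⟨S, hS⟩ := exists_clopen_split hperf A hA
    have : A ≤ C n ∨ A ≤ (C n)ᶜ := by
      rw [not_and_or, not_not, not_not, ← disjoint_iff, sdiff_eq_bot_iff] at h
      rcases h with h | h
      · exact Or.inr (le_compl_iff_disjoint_right.2 h)
      · exact Or.inl h
    exact ⟨S, fun _ => hS, this.imp inf_le_left.trans inf_le_left.trans,
      this.imp sdiff_le.trans sdiff_le.trans⟩
  choose S hS hSC hSC' using hS
  have hne : ∀ β n, splitBranch S β n ≠ ⊥ := by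
    intro β n
    induction n with
    | zero =>
      intro h
      have : Classical.arbitrary X ∈ splitBranch S β 0 := trivial
      rw [h] at this
      exact this
    | succ n ih =>
      simp only [splitBranch]
      split_ifs
      exacts [(hS n _ ih).1, (hS n _ ih).2]
  have hdec : ∀ β n, splitBranch S β (n + 1) ≤ C n ∨ splitBranch S β (n + 1) ≤ (C n)ᶜ := by
    intro β n
    simp only [splitBranch]
    split_ifs
    exacts [hSC _ _, hSC' _ _]
  have hex : ∀ β, ∃ x : X, ∀ n, x ∈ splitBranch S β n := by
    intro β
    have := IsCompact.nonempty_iInter_of_directed_nonempty_isCompact_isClosed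
      (fun n => (splitBranch S β n : Set X))
      ((splitBranch_antitone S β).directed_ge.mono_comp _ fun _ _ h => h)
      (fun n => by
        rw [nonempty_iff_ne_empty]
        exact fun h => hne β n (SetLike.coe_injective (by simpa using h)))
      (fun n => (splitBranch S β n).isClopen.isClosed.isCompact)
      (fun n => (splitBranch S β n).isClopen.isClosed)
    obtain ⟨x, hx⟩ := this
    exact ⟨x, fun n => mem_iInter.1 hx n⟩
  choose g hg using hex
  have hnear : ∀ β (U : Set X), IsOpen U → g β ∈ U → ∃ n, (splitBranch S β n : Set X) ⊆ U := by
    intro β U hU hx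
    obtain ⟨V, hV, hxV, hVU⟩ := compact_exists_isClopen_in_isOpen hU hx
    obtain ⟨n, hn⟩ := hC ⟨V, hV⟩
    refine ⟨n + 1, ?_⟩
    rcases hdec β n with h | h
    · rw [hn] at h
      exact fun y hy => hVU (h hy)
    · rw [hn] at h
      exact absurd hxV (h (hg β (n + 1)))
  have hcont : Continuous g := by
    rw [continuous_iff_continuousAt]
    intro β
    rw [ContinuousAt, _root_.tendsto_nhds]
    intro U hU hx
    obtain ⟨n, hn⟩ := hnear β U hU hx
    have : {β' : ℕ → Bool | ∀ i ∈ Finset.range n, β' i = β i} ∈ 𝓝 β := by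
      refine (Filter.eventually_all_finset _).2 fun i _ => ?_
      have h : ({β i} : Set Bool) ∈ 𝓝 (β i) := (isOpen_discrete _).mem_nhds rfl
      exact (continuous_apply i).continuousAt.eventually h
    filter_upwards [this] with β' hβ'
    apply hn
    rw [← splitBranch_congr S n fun i hi => hβ' i (Finset.mem_range.2 hi)]
    exact hg β' n
  have hinj : Function.Injective g := by
    intro β β' h
    by_contra hne'
    have hex : ∃ n, β n ≠ β' n := Function.ne_iff.1 hne'
    have h1 := hg β (Nat.find hex + 1)
    have h2 := hg β' (Nat.find hex + 1)
    have hc : splitBranch S β (Nat.find hex) = splitBranch S β' (Nat.find hex) :=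
      splitBranch_congr S _ fun i hi => not_not.1 (Nat.find_min hex hi)
    rw [← h] at h2
    have hsp := Nat.find_spec hex
    simp only [splitBranch, ← hc] at h1 h2
    cases hb : β (Nat.find hex) <;> cases hb' : β' (Nat.find hex) <;>
      simp only [hb, hb'] at h1 h2 hsp <;> simp at h1 h2 hsp
    · exact h1.2 h2.2
    · exact h2.2 h1.2
  have hsurj : Function.Surjective g := by
    intro x
    let B : ℕ → Clopens X := fun n => Nat.rec ⊤
      (fun n A => if x ∈ S n A then A ⊓ S n A else A \ S n A) n
    let β : ℕ → Bool := fun n => decide (x ∈ S n (B n))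
    have hB : ∀ n, splitBranch S β n = B n := by
      intro n
      induction n with
      | zero => rfl
      | succ n ih => simp only [splitBranch, ih, β, decide_eq_true_eq]; rfl
    have hx : ∀ n, x ∈ splitBranch S β n := by
      intro n
      induction n with
      | zero => trivial
      | succ n ih =>
        simp only [splitBranch, β, decide_eq_true_eq, hB] at ih ⊢
        split_ifs with h
        exacts [⟨ih, h⟩, ⟨ih, h⟩]
    refine ⟨β, ?_⟩
    by_contra hne'
    obtain ⟨n, hn⟩ := hnear β {x}ᶜ isOpen_compl_singleton hne'
    exact hn (hx n) rfl
  exact ⟨(hcont.homeoOfEquivCompactToT2 (f := Equiv.ofBijective g ⟨hinj, hsurj⟩)).symm⟩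

end Brouwer

section Trivialization

variable {Z G : Type*} [TopologicalSpace Z] [Group G]

/-- The defining properties of a `G`-valued local system presented by germs of flat sections. -/
structure IsFlat (Flat : Z → (Z → G) → Prop) : Prop where
  eventually : ∀ x s, Flat x s → ∀ᶠ y in 𝓝 x, Flat y s
  unique : ∀ x s s', Flat x s → Flat x s' → ∃ c, ∀ᶠ q in 𝓝 x, s' q = s q * c

open Bundle in
theorem IsFlat.exists_global {Flat : Z → (Z → G) → Prop} (hF : IsFlat Flat) {A : Set Z}
    [SimplyConnectedSpace A] [LocallyPathConnectedSpace A]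
    (hex : ∀ x ∈ A, ∃ s, Flat x s) :
    ∃ f : Z → G, ∀ x ∈ A, ∀ s, Flat x s → ∃ c, ∀ᶠ q in 𝓝[A] x, f q = s q * c := by
  classical
  let _ : TopologicalSpace G := ⊥
  have _ : DiscreteTopology G := ⟨rfl⟩
  have hex' : ∀ x : A, ∃ s, Flat x s := fun x => hex x x.2
  choose σ hσ using hex'
  let C : FiberBundleCore A A G :=
    { baseSet := fun i => {p | ∀ᶠ y in 𝓝 (p : Z), Flat y (σ i)}
      isOpen_baseSet := fun i => isOpen_setOfPred_eventually_nhds.preimage continuous_subtype_val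
      indexAt := id
      mem_baseSet_at := fun x => hF.eventually _ _ (hσ x)
      coordChange := fun i j p v => (σ j p)⁻¹ * σ i p * v
      coordChange_self := fun i x _ v => by simp
      continuousOn_coordChange := by
        rintro i j ⟨p, v⟩ ⟨⟨hi, hj⟩, -⟩
        apply ContinuousAt.continuousWithinAt
        obtain ⟨c, hc⟩ := hF.unique _ _ _ hi.self_of_nhds hj.self_of_nhds
        have h1 : ∀ᶠ q in 𝓝 (p, v), σ j (q.1 : Z) = σ i q.1 * c :=
          (continuous_subtype_val.comp continuous_fst).continuousAt.eventually hc
        have h2 : ∀ᶠ q in 𝓝 (p, v), (σ j (q.1 : Z))⁻¹ * σ i q.1 * q.2 = c⁻¹ * q.2 :=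
          h1.mono fun q hq => by simp [hq, mul_assoc]
        refine ContinuousAt.congr (f := fun q : A × G => c⁻¹ * q.2) ?_
          (h2.mono fun _ h => h.symm)
        exact ((continuous_of_discreteTopology (f := fun g : G => c⁻¹ * g)).comp
          continuous_snd).continuousAt
      coordChange_comp := fun i j k x _ v => by simp [mul_assoc] }
  have hcov : IsCoveringMap (π G C.Fiber) := FiberBundle.isCoveringMap (F := G) (E := C.Fiber)
  obtain ⟨x0⟩ : Nonempty A := inferInstance
  obtain ⟨F, ⟨-, hF1⟩, -⟩ := hcov.existsUnique_continuousMap_lifts (ContinuousMap.id A) x0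
    (⟨x0, (1 : G)⟩ : TotalSpace G C.Fiber) rfl
  have hFp : ∀ p, (F p).proj = p := fun p => congrFun hF1 p
  let v : A → G := fun p => (F p).2
  refine ⟨fun z => if h : z ∈ A then σ ⟨z, h⟩ z * v ⟨z, h⟩ else 1, fun x hx s hs => ?_⟩
  have key : ∀ᶠ q : A in 𝓝 ⟨x, hx⟩, ((C.localTriv ⟨x, hx⟩) (F q)).2 =
      ((C.localTriv ⟨x, hx⟩) (F ⟨x, hx⟩)).2 := by
    have hc : ContinuousAt (fun q : A => ((C.localTriv ⟨x, hx⟩) (F q)).2) ⟨x, hx⟩ := by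
      refine continuousAt_snd.comp (ContinuousAt.comp ?_ F.continuous.continuousAt)
      apply (C.localTriv ⟨x, hx⟩).continuousOn.continuousAt
      apply (C.localTriv ⟨x, hx⟩).open_source.mem_nhds
      rw [(C.localTriv ⟨x, hx⟩).mem_source]
      show (F ⟨x, hx⟩).proj ∈ _
      rw [hFp]
      exact C.mem_baseSet_at ⟨x, hx⟩
    exact hc.eventually ((isOpen_discrete _).mem_nhds (mem_singleton _))
  have hval : ∀ q : A, ((C.localTriv ⟨x, hx⟩) (F q)).2 =
      (σ ⟨x, hx⟩ q)⁻¹ * σ q q * v q := by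
    intro q
    have := hFp q
    rw [C.localTriv_apply]
    show (σ ⟨x, hx⟩ (F q).proj)⁻¹ * σ (F q).proj (F q).proj * v q = _
    rw [this]
  obtain ⟨c, hc⟩ := hF.unique _ _ _ hs (hσ ⟨x, hx⟩)
  refine ⟨c * ((C.localTriv ⟨x, hx⟩) (F ⟨x, hx⟩)).2, ?_⟩
  rw [nhdsWithin_eq_map_subtype_coe hx, Filter.eventually_map]
  filter_upwards [key, continuous_subtype_val.continuousAt.eventually hc] with q hq hq'
  rw [dif_pos q.2]
  rw [hval] at hq
  rw [← hq]
  simp only [Subtype.coe_eta] at *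
  rw [← mul_assoc, ← hq']
  simp [mul_assoc]
end Trivialization

section LineComplement

lemma IsPreconnected.eq_of_eventually_eq {Z G : Type*} [TopologicalSpace Z] {M : Set Z}
    (hM : IsPreconnected M) {D : Z → G} (h : ∀ x ∈ M, ∀ᶠ q in 𝓝[M] x, D q = D x)
    {x y : Z} (hx : x ∈ M) (hy : y ∈ M) : D x = D y := by
  have hc : IsLocallyConstant (fun p : M => D p) := by
    rw [IsLocallyConstant.iff_eventually_eq]
    intro p
    have := h p p.2
    rw [nhdsWithin_eq_map_subtype_coe p.2, Filter.eventually_map] at this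
    exact this
  have : PreconnectedSpace M := Subtype.preconnectedSpace hM
  exact hc.apply_eq_of_isPreconnected isPreconnected_univ (mem_univ ⟨x, hx⟩) (mem_univ ⟨y, hy⟩)

variable {n : ℕ}

local notation "𝔼" => EuclideanSpace ℝ (Fin n)

/-- Projection of `ℝⁿ` that kills the `i`-th coordinate. -/
def killCoord (i : Fin n) (x : 𝔼) : 𝔼 := x - x i • EuclideanSpace.single i 1

lemma continuous_killCoord (i : Fin n) : Continuous (killCoord i) := by
  unfold killCoord; fun_prop

lemma killCoord_apply_of_ne {i j : Fin n} (h : j ≠ i) (x : 𝔼) : killCoord i x j = x j := by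
  simp [killCoord, h]

lemma killCoord_eq_self {i : Fin n} {x : 𝔼} (h : x i = 0) : killCoord i x = x := by
  simp [killCoord, h]

lemma killCoord_add_smul (i : Fin n) (x : 𝔼) (c : ℝ) :
    killCoord i (x + c • EuclideanSpace.single i 1) = killCoord i x := by
  ext j
  by_cases h : j = i
  · subst h; simp [killCoord]
  · simp [killCoord, h]

/-- The points that can be pushed to infinity in the direction `ε • e i` off the set `Q`. -/
def shadow (i : Fin n) (ε : ℝ) (Q : Set 𝔼) : Set 𝔼 := {x | 0 < ε * x i ∨ killCoord i x ∉ Q}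

lemma isOpen_shadow (i : Fin n) (ε : ℝ) {Q : Set 𝔼} (hQ : IsClosed Q) :
    IsOpen (shadow i ε Q) := by
  have h : Continuous fun x : 𝔼 => ε * x i := by fun_prop
  exact (isOpen_lt continuous_const h).union (hQ.isOpen_compl.preimage (continuous_killCoord i))

lemma contractibleSpace_shadow (i : Fin n) {ε : ℝ} (hε : ε * ε = 1) (Q : Set 𝔼) :
    ContractibleSpace (shadow i ε Q) := by
  have hpos : ∀ x : 𝔼, 0 < ε * (x + (ε * (|x i| + 1)) • EuclideanSpace.single i 1 : 𝔼) i := by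
    intro x
    have h1 : |ε * x i| = |x i| := by
      have : |ε| = 1 := by
        have := abs_mul_abs_self ε
        nlinarith [abs_nonneg ε]
      rw [abs_mul, this, one_mul]
    have h2 := neg_abs_le (ε * x i)
    have : ε * (x + (ε * (|x i| + 1)) • EuclideanSpace.single i 1 : 𝔼) i =
        ε * x i + (ε * ε) * (|x i| + 1) := by simp; ring
    rw [this, hε]
    linarith
  let r : C(shadow i ε Q, shadow i ε Q) :=
    ⟨fun x => ⟨x.1 + (ε * (|x.1 i| + 1)) • EuclideanSpace.single i 1, Or.inl (hpos x.1)⟩,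
      by fun_prop⟩
  let p : shadow i ε Q := ⟨ε • EuclideanSpace.single i 1, Or.inl (by simp [hε])⟩
  have H1 : (ContinuousMap.id _).Homotopic r := ⟨
    { toFun := fun q => ⟨q.2.1 + ((q.1 : ℝ) * (ε * (|q.2.1 i| + 1))) • EuclideanSpace.single i 1, by
        rcases q.2.2 with h | h
        · left
          have : ε * (q.2.1 + ((q.1 : ℝ) * (ε * (|q.2.1 i| + 1))) • EuclideanSpace.single i 1 : 𝔼) i
            = ε * q.2.1 i + (ε * ε) * (q.1 * (|q.2.1 i| + 1)) := by simp; ring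
          rw [this, hε]
          have h0 := q.1.2.1
          positivity
        · right
          rw [killCoord_add_smul]
          exact h⟩
      continuous_toFun := by fun_prop
      map_zero_left := fun x => by simp
      map_one_left := fun x => by simp [r] }⟩
  have H2 : r.Homotopic (ContinuousMap.const _ p) := ⟨
    { toFun := fun q => ⟨(1 - (q.1 : ℝ)) • (r q.2).1 + (q.1 : ℝ) • p.1, Or.inl (by
        have h1 := hpos q.2.1
        have h0 := q.1.2.1
        have h2 := q.1.2.2
        have e : ε * ((1 - (q.1 : ℝ)) • (r q.2).1 + (q.1 : ℝ) • p.1 : 𝔼) i =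
          (1 - (q.1 : ℝ)) * (ε * (r q.2).1 i) + q.1 * (ε * ε) := by simp [p]; ring
        rw [e, hε, mul_one]
        rcases eq_or_lt_of_le h2 with h | h
        · rw [h]; norm_num
        · have : 0 < (1 - (q.1 : ℝ)) * (ε * (r q.2).1 i) := mul_pos (by linarith) h1
          linarith)⟩
      continuous_toFun := by fun_prop
      map_zero_left := fun x => by simp
      map_one_left := fun x => by simp }⟩
  exact (contractible_iff_id_nullhomotopic _).2 ⟨p, H1.trans H2⟩

lemma isPreconnected_killCoord_preimage {i j k : Fin n} (hij : i ≠ j) (hik : i ≠ k) (hjk : j ≠ k)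
    {Q : Set 𝔼} (hQ : ∀ x ∈ Q, x j = 0) {b : ℝ} (hb : ∀ x ∈ Q, x k ≠ b) :
    IsPreconnected {x : 𝔼 | killCoord i x ∉ Q} := by
  have hj : ∀ x : 𝔼, x j ≠ 0 → killCoord i x ∉ Q := fun x hx h =>
    hx (by rw [← killCoord_apply_of_ne hij.symm x]; exact hQ _ h)
  have hk : ∀ x : 𝔼, x k = b → killCoord i x ∉ Q := fun x hx h =>
    hb _ h (by rw [killCoord_apply_of_ne hik.symm x]; exact hx)
  have seg : ∀ x y : 𝔼, (∀ t ∈ Icc (0 : ℝ) 1, killCoord i ((1 - t) • x + t • y) ∉ Q) →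
      JoinedIn {x : 𝔼 | killCoord i x ∉ Q} x y := by
    intro x y h
    apply JoinedIn.of_segment_subset
    rintro _ ⟨a, c, ha, hc, hac, rfl⟩
    have := h c ⟨hc, by linarith⟩
    rwa [show 1 - c = a by linarith] at this
  set e : 𝔼 := EuclideanSpace.single j 1 with he
  set o : 𝔼 := b • EuclideanSpace.single k 1 with ho
  have hej : e j = 1 := by simp [he]
  have hek : e k = 0 := by simp [he, hjk.symm]
  have hoj : o j = 0 := by simp [ho, hjk]
  have hok : o k = b := by simp [ho]
  have up : ∀ x : 𝔼, killCoord i x ∉ Q → 0 ≤ x j →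
      JoinedIn {x : 𝔼 | killCoord i x ∉ Q} x (o + e) := by
    intro x hx h0
    apply seg
    intro t ht
    rcases eq_or_lt_of_le ht.1 with h | h
    · rw [← h]; simpa using hx
    · apply hj
      simp only [PiLp.add_apply, PiLp.smul_apply, smul_eq_mul, hej, hoj]
      nlinarith [ht.2, mul_nonneg (sub_nonneg.2 ht.2) h0]
  have all : ∀ x : 𝔼, killCoord i x ∉ Q → JoinedIn {x : 𝔼 | killCoord i x ∉ Q} x (o + e) := by
    intro x hx
    rcases le_or_gt 0 (x j) with h | h
    · exact up x hx h
    · refine (seg x (o - e) fun t ht => ?_).trans (seg _ _ fun t ht => ?_)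
      · apply hj
        simp only [PiLp.add_apply, PiLp.smul_apply, smul_eq_mul, PiLp.sub_apply, hej, hoj]
        rcases eq_or_lt_of_le ht.1 with h' | h'
        · rw [← h']; linarith
        · nlinarith [ht.2, mul_nonneg (sub_nonneg.2 ht.2) (neg_nonneg.2 h.le)]
      · apply hk
        simp only [PiLp.add_apply, PiLp.smul_apply, smul_eq_mul, PiLp.sub_apply, hek, hok]
        ring
  refine IsPathConnected.isConnected ⟨o + e, hj _ (by simp [hej, hoj]), fun {y} hy => (all y hy).symm⟩
    |>.isPreconnected

theorem IsFlat.exists_global_of_subset_coordLine {G : Type*} [Group G] {Flat : 𝔼 → (𝔼 → G) → Prop}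
    (hF : IsFlat Flat) (hn : 3 ≤ n) {Q : Set 𝔼} (hQ : IsCompact Q) (hQl : Q ⊆ coordLine n)
    (hex : ∀ x ∉ Q, ∃ s, Flat x s) :
    ∃ f : 𝔼 → G, ∀ x ∉ Q, ∀ s, Flat x s → ∃ c, ∀ᶠ q in 𝓝 x, f q = s q * c := by
  classical
  let i : Fin n := ⟨1, by omega⟩
  let j : Fin n := ⟨2, by omega⟩
  let k : Fin n := ⟨0, by omega⟩
  have hQi : ∀ x ∈ Q, x i = 0 := fun x hx => hQl hx i one_ne_zero
  have hQj : ∀ x ∈ Q, x j = 0 := fun x hx => hQl hx j two_ne_zero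
  have hsub : ∀ ε, ∀ x ∈ shadow i ε Q, x ∉ Q := by
    rintro ε x (h | h) hx
    · rw [hQi x hx] at h; simp at h
    · rw [killCoord_eq_self (hQi x hx)] at h; exact h hx
  have hloc : ∀ ε : ℝ, ε * ε = 1 → ∃ f : 𝔼 → G, ∀ x ∈ shadow i ε Q, ∀ s, Flat x s →
      ∃ c, ∀ᶠ q in 𝓝 x, f q = s q * c := by
    intro ε hε
    have ho := isOpen_shadow i ε hQ.isClosed
    have := contractibleSpace_shadow i hε Q
    have : LocallyPathConnectedSpace (shadow i ε Q) := ho.locallyPathConnectedSpace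
    obtain ⟨f, hf⟩ := hF.exists_global (A := shadow i ε Q) fun x hx => hex x (hsub ε x hx)
    refine ⟨f, fun x hx s hs => ?_⟩
    have := hf x hx s hs
    rwa [ho.nhdsWithin_eq hx] at this
  obtain ⟨f, hf⟩ := hloc 1 (by norm_num)
  obtain ⟨g, hg⟩ := hloc (-1) (by norm_num)
  obtain ⟨b, hb⟩ : ∃ b : ℝ, ∀ x ∈ Q, x k ≠ b := by
    have hc : Continuous fun x : 𝔼 => x k := by fun_prop
    obtain ⟨B, hB⟩ := (hQ.image hc).bddAbove
    refine ⟨B + 1, fun x hx h => ?_⟩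
    have := hB (mem_image_of_mem _ hx)
    simp only [h] at this
    linarith
  have hM := isPreconnected_killCoord_preimage (i := i) (j := j) (k := k) (by simp [i, j])
    (by simp [i, k]) (by simp [j, k]) hQj hb
  have hMeq : ∀ x : 𝔼, x ∈ shadow i 1 Q → x ∈ shadow i (-1) Q → killCoord i x ∉ Q := by
    rintro x (h | h) (h' | h')
    · linarith
    all_goals assumption
  have hD : ∃ d : G, ∀ x, killCoord i x ∉ Q → (f x)⁻¹ * g x = d := by
    have h : ∀ x ∈ {x : 𝔼 | killCoord i x ∉ Q}, ∀ᶠ q in 𝓝[{x : 𝔼 | killCoord i x ∉ Q}] x,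
        (f q)⁻¹ * g q = (f x)⁻¹ * g x := by
      intro x hx
      obtain ⟨s, hs⟩ := hex x (hsub 1 x (Or.inr hx))
      obtain ⟨c, hc⟩ := hf x (Or.inr hx) s hs
      obtain ⟨c', hc'⟩ := hg x (Or.inr hx) s hs
      have hq : ∀ q, f q = s q * c → g q = s q * c' → (f q)⁻¹ * g q = c⁻¹ * c' := by
        intro q h1 h2; rw [h1, h2]; group
      apply Filter.Eventually.filter_mono nhdsWithin_le_nhds
      filter_upwards [hc, hc'] with q h1 h2
      rw [hq q h1 h2, hq x hc.self_of_nhds hc'.self_of_nhds]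
    by_cases hne : ∃ x : 𝔼, killCoord i x ∉ Q
    · obtain ⟨x0, hx0⟩ := hne
      exact ⟨_, fun x hx => hM.eq_of_eventually_eq h hx hx0⟩
    · push Not at hne
      exact ⟨1, fun x hx => absurd (hne x) hx⟩
  obtain ⟨d, hd⟩ := hD
  refine ⟨fun q => if q ∈ shadow i 1 Q then f q * d else g q, fun x hx s hs => ?_⟩
  by_cases h : x ∈ shadow i 1 Q
  · obtain ⟨c, hc⟩ := hf x h s hs
    refine ⟨c * d, ?_⟩
    filter_upwards [hc, (isOpen_shadow i 1 hQ.isClosed).mem_nhds h] with q h1 h2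
    rw [if_pos h2, h1, mul_assoc]
  · have h' : x ∈ shadow i (-1) Q := by
      rcases lt_trichotomy (x i) 0 with h0 | h0 | h0
      · left; linarith
      · right; rwa [killCoord_eq_self h0]
      · exact absurd (Or.inl (by linarith)) h
    obtain ⟨c, hc⟩ := hg x h' s hs
    refine ⟨c, ?_⟩
    filter_upwards [hc, (isOpen_shadow i (-1) hQ.isClosed).mem_nhds h'] with q h1 h2
    split_ifs with h3
    · rw [← h1, ← hd q (hMeq q h3 h2)]; group
    · exact h1

theorem IsFlat.exists_global_of_tameSet {G : Type*} [Group G] {Flat : 𝔼 → (𝔼 → G) → Prop}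
    (hF : IsFlat Flat) (hn : 3 ≤ n) {P : Set 𝔼} (hP : IsCompact P) (hPt : TameSet P)
    (hex : ∀ x ∉ P, ∃ s, Flat x s) :
    ∃ f : 𝔼 → G, ∀ x ∉ P, ∀ s, Flat x s → ∃ c, ∀ᶠ q in 𝓝 x, f q = s q * c := by
  obtain ⟨h, hh⟩ := hPt
  have hF' : IsFlat fun y (s : 𝔼 → G) => Flat (h.symm y) (s ∘ h) :=
    ⟨fun y s hs => h.symm.continuous.continuousAt.eventually (hF.eventually _ _ hs),
      fun y s s' hs hs' => by
        obtain ⟨c, hc⟩ := hF.unique _ _ _ hs hs'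
        refine ⟨c, ?_⟩
        have := h.symm.continuous.continuousAt.eventually hc
        filter_upwards [this] with q hq
        simpa using hq⟩
  obtain ⟨f, hf⟩ := hF'.exists_global_of_subset_coordLine hn (hP.image h.continuous) hh
    fun y hy => by
      obtain ⟨s, hs⟩ := hex (h.symm y) fun hy' => hy ⟨_, hy', by simp⟩
      exact ⟨s ∘ h.symm, by simpa [Function.comp_assoc] using hs⟩
  refine ⟨f ∘ h, fun x hx s hs => ?_⟩
  obtain ⟨c, hc⟩ := hf (h x) (by rintro ⟨y, hy, hxy⟩; exact hx (h.injective hxy ▸ hy)) (s ∘ h.symm)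
    (by simpa [Function.comp_assoc] using hs)
  refine ⟨c, ?_⟩
  filter_upwards [h.continuous.continuousAt.eventually hc] with q hq
  simpa using hq

end LineComplement

section Gluing

/-- Data for extending a local system on `M`, with prescribed transport `ν` outside `V`, over a
space `Z` containing disjoint copies `e j` of `M`, by the transport `t` outside the copies of `V`
and the gauge changes `c j` on the copies of `M`. -/
structure Gluing (M Z J G : Type*) [TopologicalSpace M] [TopologicalSpace Z] [Group G] where
  V : Set M
  e : J → M → Z
  ν : M → M → G
  t : Z → Z → G
  c : J → Z → G
  isOpenEmbedding : ∀ j, IsOpenEmbedding (e j)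
  disjoint : ∀ i j x y, e i x = e j y → i = j
  isClosed : IsClosed (⋃ j, e j '' V)
  trans : ∀ x ∉ ⋃ j, e j '' V, ∀ᶠ y in 𝓝 x, ∀ᶠ q in 𝓝 y, t q x = t q y * t y x
  star : ∀ j, ∀ x ∉ V, ∀ᶠ q in 𝓝 x, t (e j q) (e j x) = c j (e j q) * ν q x * (c j (e j x))⁻¹

variable {M Z J G : Type*} [TopologicalSpace M] [TopologicalSpace Z] [Group G]

/-- The local system `Flat` has transport `ν` outside `V`. -/
def OuterLaw (V : Set M) (ν : M → M → G) (Flat : M → (M → G) → Prop) : Prop :=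
  ∀ x ∉ V, ∀ s, Flat x s → ∀ᶠ q in 𝓝 x, s q = ν q x * s x

namespace Gluing

variable (D : Gluing M Z J G)

/-- The local system on `Z` glued from `Flat` along `D`. -/
def Paste (Flat : M → (M → G) → Prop) (x : Z) (s : Z → G) : Prop :=
  (x ∉ ⋃ j, D.e j '' D.V ∧ ∀ᶠ y in 𝓝 x, ∀ᶠ q in 𝓝 y, s q = D.t q y * s y) ∨
    ∃ j x₀ s', x = D.e j x₀ ∧ Flat x₀ s' ∧ ∀ᶠ q in 𝓝 x₀, s (D.e j q) = D.c j (D.e j q) * s' q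

variable {D} {Flat : M → (M → G) → Prop}

lemma Paste.mono {Flat' : M → (M → G) → Prop} (h : ∀ x s, Flat x s → Flat' x s) {x : Z}
    {s : Z → G} (hs : D.Paste Flat x s) : D.Paste Flat' x s :=
  hs.imp id fun ⟨j, x₀, s', h1, h2, h3⟩ => ⟨j, x₀, s', h1, h _ _ h2, h3⟩

lemma paste_exists_of_notMem {x : Z} (hx : x ∉ ⋃ j, D.e j '' D.V) :
    ∃ s, D.Paste Flat x s := ⟨fun q => D.t q x, Or.inl ⟨hx, D.trans x hx⟩⟩

lemma paste_exists_of_flat {j : J} {x : M} {s : M → G} (hs : Flat x s) :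
    ∃ s, D.Paste Flat (D.e j x) s := by
  have : Nonempty M := ⟨x⟩
  refine ⟨fun z => D.c j z * s (Function.invFun (D.e j) z), Or.inr ⟨j, x, s, rfl, hs, ?_⟩⟩
  refine Filter.Eventually.of_forall fun q => ?_
  simp only [Function.leftInverse_invFun (D.isOpenEmbedding j).injective q]

lemma eventually_map {j : J} {x : M} {p : Z → Prop} :
    (∀ᶠ z in 𝓝 (D.e j x), p z) ↔ ∀ᶠ q in 𝓝 x, p (D.e j q) := by
  rw [← (D.isOpenEmbedding j).map_nhds_eq, Filter.eventually_map]

lemma Paste.outer (hO : OuterLaw D.V D.ν Flat) {j : J} {x : M} (hx : x ∉ D.V) {s : Z → G}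
    (hs : D.Paste Flat (D.e j x) s) :
    ∀ᶠ q in 𝓝 x, s (D.e j q) = D.c j (D.e j q) * D.ν q x * (D.c j (D.e j x))⁻¹ * s (D.e j x) := by
  rcases hs with ⟨-, h⟩ | ⟨i, x₀, s', h1, h2, h3⟩
  · filter_upwards [eventually_map.1 h.self_of_nhds, D.star j x hx] with q hq hq'
    rw [hq, hq']
  · obtain rfl := D.disjoint _ _ _ _ h1
    obtain rfl := (D.isOpenEmbedding j).injective h1
    filter_upwards [h3, hO x hx s' h2] with q hq hq'
    rw [hq, hq', h3.self_of_nhds]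
    group

lemma paste_isFlat (hF : IsFlat Flat) (hO : OuterLaw D.V D.ν Flat) : IsFlat (D.Paste Flat) := by
  have hmix : ∀ (x : Z) (s : Z → G),
      (x ∉ ⋃ j, D.e j '' D.V ∧ ∀ᶠ y in 𝓝 x, ∀ᶠ q in 𝓝 y, s q = D.t q y * s y) →
      ∀ s₂, D.Paste Flat x s₂ → ∃ c, ∀ᶠ q in 𝓝 x, s₂ q = s q * c := by
    rintro x s ⟨hx, hs⟩ s₂ (⟨-, hs₂⟩ | ⟨j, x₀, s', rfl, h2, h3⟩)
    · refine ⟨(s x)⁻¹ * s₂ x, ?_⟩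
      filter_upwards [hs.self_of_nhds, hs₂.self_of_nhds] with q h1 h2
      rw [h1, h2]; group
    · have hx₀ : x₀ ∉ D.V := fun h => hx (mem_iUnion.2 ⟨j, x₀, h, rfl⟩)
      refine ⟨(s (D.e j x₀))⁻¹ * s₂ (D.e j x₀), eventually_map.2 ?_⟩
      filter_upwards [Paste.outer hO hx₀ (Or.inl ⟨hx, hs⟩),
        Paste.outer hO hx₀ (Or.inr ⟨j, x₀, s', rfl, h2, h3⟩)] with q h1 h2
      rw [h1, h2]; group
  refine ⟨?_, ?_⟩
  · rintro x s (⟨hx, hs⟩ | ⟨j, x₀, s', rfl, h2, h3⟩)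
    · filter_upwards [hs.eventually_nhds, D.isClosed.isOpen_compl.mem_nhds hx] with y h1 h2
      exact Or.inl ⟨h2, h1⟩
    · rw [eventually_map]
      filter_upwards [hF.eventually _ _ h2, h3.eventually_nhds] with y h4 h5
      exact Or.inr ⟨j, y, s', rfl, h4, h5⟩
  · rintro x s s₂ (hs | ⟨j, x₀, s', rfl, h2, h3⟩) hs₂
    · exact hmix x s hs s₂ hs₂
    · rcases hs₂ with hs₂ | ⟨i, x₁, s'', h1, h4, h5⟩
      · obtain ⟨c, hc⟩ := hmix _ s₂ hs₂ s (Or.inr ⟨j, x₀, s', rfl, h2, h3⟩)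
        exact ⟨c⁻¹, hc.mono fun q hq => by rw [hq]; group⟩
      · obtain rfl := D.disjoint _ _ _ _ h1
        obtain rfl := (D.isOpenEmbedding j).injective h1
        obtain ⟨c, hc⟩ := hF.unique _ _ _ h2 h4
        refine ⟨c, eventually_map.2 ?_⟩
        filter_upwards [hc, h3, h5] with q h6 h7 h8
        rw [h8, h7, h6, mul_assoc]

lemma paste_outerLaw {D : Gluing M M J G} {Flat : M → (M → G) → Prop}
    (hV : ∀ j x, D.e j x ∈ D.V) (hν : ∀ x ∉ D.V, ∀ᶠ q in 𝓝 x, D.t q x = D.ν q x) :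
    OuterLaw D.V D.ν (D.Paste Flat) := by
  rintro x hx s (⟨-, h⟩ | ⟨j, x₀, s', rfl, -⟩)
  · filter_upwards [h.self_of_nhds, hν x hx] with q h1 h2
    rw [h1, h2]
  · exact absurd (hV j x₀) hx

/-- The system on `M` obtained by gluing `k` times. -/
def level (D : Gluing M M J G) : ℕ → M → (M → G) → Prop
  | 0 => fun _ _ => False
  | k + 1 => D.Paste (level D k)

/-- The `k`-fold images of `V`. -/
def stage (D : Gluing M M J G) : ℕ → Set M
  | 0 => D.V
  | k + 1 => ⋃ j, D.e j '' stage D k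

/-- The limit system. -/
def limit (D : Gluing M M J G) (x : M) (s : M → G) : Prop := ∃ k, D.level k x s

lemma level_mono (D : Gluing M M J G) {x : M} {s : M → G} {k l : ℕ} (hkl : k ≤ l)
    (h : D.level k x s) : D.level l x s := by
  have step : ∀ k x s, D.level k x s → D.level (k + 1) x s := by
    intro k
    induction k with
    | zero => exact fun _ _ h => h.elim
    | succ k ih => exact fun x s h => Paste.mono ih h
  induction hkl with
  | refl => exact h
  | step _ ih => exact step _ _ _ ih

lemma limit_exists {D : Gluing M M J G} (hV : ∀ j x, D.e j x ∈ D.V) {x : M}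
    (hx : x ∉ ⋂ k, D.stage k) :
    ∃ s, D.limit x s := by
  have key : ∀ k x, x ∉ D.stage (k + 1) → ∃ s, D.level (k + 1) x s := by
    intro k
    induction k with
    | zero => exact fun x hx => paste_exists_of_notMem hx
    | succ k ih =>
      intro x hx
      by_cases h : x ∈ ⋃ j, D.e j '' D.V
      · obtain ⟨j, x₀, -, rfl⟩ := mem_iUnion.1 h
        obtain ⟨s, hs⟩ := ih x₀ fun h' => hx (mem_iUnion.2 ⟨j, x₀, h', rfl⟩)
        exact paste_exists_of_flat hs
      · exact paste_exists_of_notMem h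
  rw [mem_iInter, not_forall] at hx
  obtain ⟨k, hk⟩ := hx
  cases k with
  | zero =>
    obtain ⟨s, hs⟩ := key 0 x fun h => by
      obtain ⟨j, y, -, rfl⟩ := mem_iUnion.1 h
      exact hk (hV j y)
    exact ⟨s, 1, hs⟩
  | succ k =>
    obtain ⟨s, hs⟩ := key k x hk
    exact ⟨s, k + 1, hs⟩

section

variable {D : Gluing M M J G} (hV : ∀ j x, D.e j x ∈ D.V)
  (hν : ∀ x ∉ D.V, ∀ᶠ q in 𝓝 x, D.t q x = D.ν q x)

include hV hν

lemma level_spec (k : ℕ) : IsFlat (D.level k) ∧ OuterLaw D.V D.ν (D.level k) := by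
  induction k with
  | zero => exact ⟨⟨fun _ _ h => h.elim, fun _ _ _ h => h.elim⟩, fun _ _ _ h => h.elim⟩
  | succ k ih => exact ⟨paste_isFlat ih.1 ih.2, paste_outerLaw hV hν⟩

lemma limit_isFlat : IsFlat D.limit := by
  refine ⟨fun x s ⟨k, hk⟩ => ?_, fun x s s' ⟨k, hk⟩ ⟨l, hl⟩ => ?_⟩
  · filter_upwards [(level_spec hV hν k).1.eventually _ _ hk] with y hy
    exact ⟨k, hy⟩
  · exact (level_spec hV hν (max k l)).1.unique _ _ _ (D.level_mono (le_max_left _ _) hk)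
      (D.level_mono (le_max_right _ _) hl)

lemma limit_outerLaw : OuterLaw D.V D.ν D.limit :=
  fun x hx s ⟨k, hk⟩ => (level_spec hV hν k).2 x hx s hk

end

end Gluing

end Gluing

section Transport

namespace Quadrant

/-- The values of the local systems. -/
abbrev Gp := Equiv.Perm (Fin 5)

def ga : Gp := Equiv.swap 2 3 * Equiv.swap 3 4
def gb : Gp := Equiv.swap 0 1 * Equiv.swap 1 2
def gc : Gp := Equiv.swap 1 2 * Equiv.swap 2 3
def he : Gp := Equiv.swap 1 2 * Equiv.swap 2 4
def ho : Gp := Equiv.swap 0 3 * Equiv.swap 3 2 * Equiv.swap 2 1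

lemma gc_ne_one : gc ≠ 1 := by decide

/-- The transport between quadrants outside the solid torus: it is nontrivial only across the
negative `z`-axis. A quadrant is a pair `(0 ≤ y, 0 ≤ z)`. -/
def nu : Bool × Bool → Bool × Bool → Gp
  | (false, false), (true, false) => gc⁻¹
  | (true, false), (false, false) => gc
  | _, _ => 1

/-- Potentials for the transport between quadrants, depending on whether the point is inside the
spanning disks of the even and of the odd circles. -/
def pot : Bool → Bool → Bool × Bool → Gp
  | true, false, (false, false) => gc⁻¹ * ga
  | true, false, (true, false) => ga
  | false, true, (false, _) => gb⁻¹
  | true, true, (false, true) => gb⁻¹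
  | true, true, (false, false) => gc⁻¹ * ga * gb⁻¹
  | true, true, (true, false) => ga
  | _, _, _ => 1

/-- The transport between quadrants at a point with the given states. -/
def tr (d d' : Bool) (q x : Bool × Bool) : Gp :=
  if d || d' then pot d d' q * (pot d d' x)⁻¹ else nu q x

/-- Gauge on the even tubes and on the odd tubes. -/
def gauge : Bool → Bool × Bool → Gp
  | true, (false, _) => gb⁻¹ * he
  | true, (true, _) => he
  | false, (_, true) => ho
  | false, (false, false) => gc⁻¹ * ga * ho
  | false, (true, false) => ga * ho

lemma tr_self (d d' : Bool) (x : Bool × Bool) : tr d d' x x = 1 := by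
  obtain ⟨x, x'⟩ := x
  unfold tr
  split_ifs
  · simp
  · cases x <;> cases x' <;> rfl

lemma tr_mul_of_state {d d' : Bool} (h : d || d') (q y x : Bool × Bool) :
    tr d d' q x = tr d d' q y * tr d d' y x := by
  simp only [tr, if_pos h]; group

lemma tr_fst_irrel (d₁ d₂ d' s a b : Bool) : tr d₁ d' (a, s) (b, s) = tr d₂ d' (a, s) (b, s) := by
  revert d₁ d₂ d' s a b; decide +kernel

lemma tr_snd_irrel (d d₁ d₂ s a b : Bool) : tr d d₁ (s, a) (s, b) = tr d d₂ (s, a) (s, b) := by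
  revert d₁ d₂ d s a b; decide +kernel

lemma tr_mul_of_fst (d d' s q y x : Bool) :
    tr d d' (s, q) (s, x) = tr d d' (s, q) (s, y) * tr d d' (s, y) (s, x) := by
  rw [tr_snd_irrel d d' true, tr_snd_irrel d d' true, tr_snd_irrel d d' true]
  exact tr_mul_of_state (by simp) _ _ _

lemma tr_mul_of_snd (d d' s q y x : Bool) :
    tr d d' (q, s) (x, s) = tr d d' (q, s) (y, s) * tr d d' (y, s) (x, s) := by
  rw [tr_fst_irrel d true, tr_fst_irrel d true, tr_fst_irrel d true]
  exact tr_mul_of_state (by simp) _ _ _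

lemma tr_even (z s s' y y' : Bool) : tr (!z) true (s, y) (s', y') =
    gauge true (s, y) * nu (y, z) (y', z) * (gauge true (s', y'))⁻¹ := by
  revert z s s' y y'; decide +kernel

lemma tr_odd (z s s' y y' : Bool) : tr true (!z) (y, s) (y', s') =
    gauge false (y, s) * nu (y, z) (y', z) * (gauge false (y', s'))⁻¹ := by
  revert z s s' y y'; decide +kernel

lemma nu_of_fst (y z z' : Bool) : nu (y, z) (y, z') = 1 := by
  cases y <;> cases z <;> cases z' <;> rfl

lemma nu_of_snd_true (y y' : Bool) (z : Bool) : nu (y, true) (y', z) = 1 := by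
  cases y <;> cases y' <;> cases z <;> rfl

end Quadrant

end Transport

section Attractor

/-- A finite system of injective maps of a compact set `B` with disjoint images, together with a
compact condensation set `C`. -/
structure CondensedIFS (E J : Type*) [MetricSpace E] where
  f : J → E → E
  B : Set E
  C : Set E
  continuous : ∀ j, Continuous (f j)
  injective : ∀ j, Function.Injective (f j)
  isCompact : IsCompact B
  isCompact_C : IsCompact C
  mapsTo : ∀ j, MapsTo (f j) B B
  subset : C ⊆ B
  disjoint : ∀ i j, ∀ x ∈ B, ∀ y ∈ B, f i x = f j y → i = j
  disjoint_C : ∀ j, ∀ x ∈ B, f j x ∉ C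
  shrink : ∀ ε > 0, ∃ m : ℕ, ∀ w : List J, w.length = m → ∀ x ∈ B, ∀ y ∈ B,
    dist (w.foldr f x) (w.foldr f y) < ε

namespace CondensedIFS

variable {E J : Type*} [MetricSpace E] (S : CondensedIFS E J)

/-- The approximations of the attractor. -/
def stage : ℕ → Set E
  | 0 => S.B
  | m + 1 => S.C ∪ ⋃ j, S.f j '' stage m

/-- The attractor. -/
def attractor : Set E := ⋂ m, S.stage m

lemma stage_succ_subset (m : ℕ) : S.stage (m + 1) ⊆ S.stage m := by
  induction m with
  | zero =>
    rintro x (hx | hx)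
    · exact S.subset hx
    · obtain ⟨j, y, hy, rfl⟩ := mem_iUnion.1 hx
      exact S.mapsTo j hy
  | succ m ih => exact union_subset_union_right _ (iUnion_mono fun j => image_mono ih)

lemma stage_subset (m : ℕ) : S.stage m ⊆ S.B := by
  induction m with
  | zero => exact subset_rfl
  | succ m ih => exact (S.stage_succ_subset m).trans ih

lemma attractor_subset : S.attractor ⊆ S.B := iInter_subset _ 0

lemma isCompact_stage [Finite J] (m : ℕ) : IsCompact (S.stage m) := by
  induction m with
  | zero => exact S.isCompact
  | succ m ih => exact S.isCompact_C.union (isCompact_iUnion fun j => ih.image (S.continuous j))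

lemma isCompact_attractor [Finite J] : IsCompact S.attractor :=
  (S.isCompact_stage 0).of_isClosed_subset
    (isClosed_iInter fun m => (S.isCompact_stage m).isClosed) (iInter_subset _ 0)

lemma attractor_eq : S.attractor = S.C ∪ ⋃ j, S.f j '' S.attractor := by
  ext x
  constructor
  · intro hx
    rcases mem_iInter.1 hx 1 with h | h
    · exact Or.inl h
    · obtain ⟨j, y, hy, rfl⟩ := mem_iUnion.1 h
      refine Or.inr (mem_iUnion.2 ⟨j, y, mem_iInter.2 fun m => ?_, rfl⟩)
      rcases mem_iInter.1 hx (m + 1) with h | h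
      · exact absurd h (S.disjoint_C j y hy)
      · obtain ⟨i, z, hz, hzy⟩ := mem_iUnion.1 h
        obtain rfl := S.disjoint _ _ _ (S.stage_subset m hz) _ hy hzy
        rwa [← S.injective i hzy]
  · intro hx
    refine mem_iInter.2 fun m => ?_
    cases m with
    | zero =>
      rcases hx with h | h
      · exact S.subset h
      · obtain ⟨j, y, hy, rfl⟩ := mem_iUnion.1 h
        exact S.mapsTo j (S.attractor_subset hy)
    | succ m =>
      refine union_subset_union_right _ (iUnion_mono fun j => image_mono ?_) hx
      exact iInter_subset _ m

lemma C_subset_attractor : S.C ⊆ S.attractor := by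
  rw [attractor_eq]; exact subset_union_left

lemma map_attractor {j : J} {x : E} (hx : x ∈ S.attractor) : S.f j x ∈ S.attractor := by
  rw [attractor_eq]
  exact Or.inr (mem_iUnion.2 ⟨j, x, hx, rfl⟩)

lemma foldr_attractor (w : List J) {x : E} (hx : x ∈ S.attractor) :
    w.foldr S.f x ∈ S.attractor := by
  induction w with
  | nil => exact hx
  | cons j w ih => exact S.map_attractor ih

lemma foldr_injective (w : List J) : Function.Injective (w.foldr S.f) := by
  induction w with
  | nil => exact fun _ _ h => h
  | cons j w ih => exact fun _ _ h => ih (S.injective j h)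

lemma foldr_continuous (w : List J) : Continuous fun x => w.foldr S.f x := by
  induction w with
  | nil => exact continuous_id
  | cons j w ih => exact (S.continuous j).comp ih

lemma attractor_nonempty [Finite J] [Nonempty J] (hB : S.B.Nonempty) : S.attractor.Nonempty := by
  refine IsCompact.nonempty_iInter_of_sequence_nonempty_isCompact_isClosed _ S.stage_succ_subset
    (fun m => ?_) (S.isCompact_stage 0) fun m => (S.isCompact_stage m).isClosed
  induction m with
  | zero => exact hB
  | succ m ih =>
    obtain ⟨x, hx⟩ := ih
    exact ⟨_, Or.inr (mem_iUnion.2 ⟨Classical.arbitrary J, x, hx, rfl⟩)⟩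

lemma exists_word {x : E} (hx : x ∈ S.attractor) (m : ℕ) :
    (∃ w : List J, ∃ y ∈ S.C, x = w.foldr S.f y) ∨
      ∃ w : List J, w.length = m ∧ ∃ y ∈ S.attractor, x = w.foldr S.f y := by
  induction m generalizing x with
  | zero => exact Or.inr ⟨[], rfl, x, hx, rfl⟩
  | succ m ih =>
    rw [attractor_eq] at hx
    rcases hx with h | h
    · exact Or.inl ⟨[], x, h, rfl⟩
    · obtain ⟨j, y, hy, rfl⟩ := mem_iUnion.1 h
      rcases ih hy with ⟨w, z, hz, rfl⟩ | ⟨w, hw, z, hz, rfl⟩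
      · exact Or.inl ⟨j :: w, z, hz, rfl⟩
      · exact Or.inr ⟨j :: w, by simp [hw], z, hz, rfl⟩

/-- Every neighbourhood of a point of the attractor contains a whole copy of the attractor through
that point, unless the point belongs to a copy of the condensation set. -/
lemma exists_copy {x : E} (hx : x ∈ S.attractor) :
    (∃ w : List J, ∃ y ∈ S.C, x = w.foldr S.f y) ∨
      ∀ U ∈ 𝓝 x, ∃ w : List J, (∃ y ∈ S.attractor, x = w.foldr S.f y) ∧
        ∀ z ∈ S.attractor, w.foldr S.f z ∈ U := by
  by_cases h : ∃ w : List J, ∃ y ∈ S.C, x = w.foldr S.f y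
  · exact Or.inl h
  refine Or.inr fun U hU => ?_
  obtain ⟨ε, hε, hεU⟩ := Metric.mem_nhds_iff.1 hU
  obtain ⟨m, hm⟩ := S.shrink ε hε
  obtain ⟨w, hw, y, hy, rfl⟩ := (S.exists_word hx m).resolve_left h
  exact ⟨w, ⟨y, hy, rfl⟩, fun z hz => hεU (hm w hw _ (S.attractor_subset hz) _
    (S.attractor_subset hy))⟩

lemma isPreconnected_subset [Finite J] {t : Set E} (ht : IsPreconnected t)
    (htA : t ⊆ S.attractor) :
    t ⊆ S.C ∨ ∃ j, t ⊆ S.f j '' S.attractor := by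
  by_cases h : ∃ j, (t ∩ S.f j '' S.attractor).Nonempty
  · obtain ⟨j, hj⟩ := h
    have hc : ∀ i, IsClosed (S.f i '' S.attractor) := fun i =>
      (S.isCompact_attractor.image (S.continuous i)).isClosed
    have hv : IsClosed (S.C ∪ ⋃ i : {i // i ≠ j}, S.f i '' S.attractor) :=
      S.isCompact_C.isClosed.union (isClosed_iUnion_of_finite fun i => hc i)
    have hcov : t ⊆ S.f j '' S.attractor ∪ (S.C ∪ ⋃ i : {i // i ≠ j}, S.f i '' S.attractor) := by
      intro x hx
      have := htA hx
      rw [attractor_eq] at this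
      rcases this with h | h
      · exact Or.inr (Or.inl h)
      · obtain ⟨i, y, hy, rfl⟩ := mem_iUnion.1 h
        by_cases hij : i = j
        · subst hij; exact Or.inl ⟨y, hy, rfl⟩
        · exact Or.inr (Or.inr (mem_iUnion.2 ⟨⟨i, hij⟩, y, hy, rfl⟩))
    have hdis : Disjoint (S.f j '' S.attractor)
        (S.C ∪ ⋃ i : {i // i ≠ j}, S.f i '' S.attractor) := by
      rw [Set.disjoint_left]
      rintro _ ⟨y, hy, rfl⟩ (h | h)
      · exact S.disjoint_C j y (S.attractor_subset hy) h
      · obtain ⟨i, z, hz, hzy⟩ := mem_iUnion.1 h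
        exact i.2 (S.disjoint _ _ _ (S.attractor_subset hz) _ (S.attractor_subset hy) hzy)
    have := isPreconnected_iff_subset_of_disjoint_closed.1 ht _ _ (hc j) hv hcov
      (by rw [hdis.inter_eq, inter_empty])
    rcases this with h | h
    · exact Or.inr ⟨j, h⟩
    · obtain ⟨x, hx, hx'⟩ := hj
      exact absurd (h hx) (Set.disjoint_left.1 hdis hx')
  · left
    intro x hx
    have := htA hx
    rw [attractor_eq] at this
    rcases this with h' | h'
    · exact h'
    · obtain ⟨j, hj⟩ := mem_iUnion.1 h'
      exact absurd ⟨j, x, hx, hj⟩ h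

lemma isPreconnected_subset_word [Finite J] {t : Set E} (ht : IsPreconnected t)
    (htA : t ⊆ S.attractor) (hne : t.Nonempty) (m : ℕ) :
    (∃ w : List J, t ⊆ w.foldr S.f '' S.C) ∨
      ∃ w : List J, w.length = m ∧ t ⊆ w.foldr S.f '' S.attractor := by
  induction m generalizing t with
  | zero => exact Or.inr ⟨[], rfl, fun x hx => ⟨x, htA hx, rfl⟩⟩
  | succ m ih =>
    rcases S.isPreconnected_subset ht htA with h | ⟨j, hj⟩
    · exact Or.inl ⟨[], fun x hx => ⟨x, h hx, rfl⟩⟩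
    · have hemb : IsClosedEmbedding (S.attractor.domRestrict (S.f j)) := by
        have : CompactSpace S.attractor := isCompact_iff_compactSpace.1 S.isCompact_attractor
        exact ((S.continuous j).comp continuous_subtype_val).isClosedEmbedding
          fun x y h => Subtype.ext (S.injective j h)
      have ht' : IsPreconnected (S.f j ⁻¹' t ∩ S.attractor) := by
        have : IsPreconnected (S.attractor.domRestrict (S.f j) ⁻¹' t) := by
          refine hemb.isInducing.isPreconnected_image.1 ?_
          rw [image_preimage_eq_inter_range, range_domRestrict, inter_eq_left.2 hj]
          exact ht
        have := this.image Subtype.val continuous_subtype_val.continuousOn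
        convert! this using 1
        ext x
        simp [and_comm, Set.domRestrict]
      have hne' : (S.f j ⁻¹' t ∩ S.attractor).Nonempty := by
        obtain ⟨x, hx⟩ := hne
        obtain ⟨y, hy, rfl⟩ := hj hx
        exact ⟨y, hx, hy⟩
      rcases ih ht' inter_subset_right hne' with ⟨w, hw⟩ | ⟨w, hwm, hw⟩
      · refine Or.inl ⟨j :: w, fun x hx => ?_⟩
        obtain ⟨y, hy, rfl⟩ := hj hx
        obtain ⟨z, hz, rfl⟩ := hw ⟨hx, hy⟩
        exact ⟨z, hz, rfl⟩
      · refine Or.inr ⟨j :: w, by simp [hwm], fun x hx => ?_⟩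
        obtain ⟨y, hy, rfl⟩ := hj hx
        obtain ⟨z, hz, rfl⟩ := hw ⟨hx, hy⟩
        exact ⟨z, hz, rfl⟩

lemma isTotallyDisconnected_attractor [Finite J] (hC : IsTotallyDisconnected S.C) :
    IsTotallyDisconnected S.attractor := by
  intro t htA ht
  rcases t.eq_empty_or_nonempty with rfl | hne
  · exact subsingleton_empty
  by_cases h : ∃ w : List J, t ⊆ w.foldr S.f '' S.C
  · obtain ⟨w, hw⟩ := h
    have hemb : IsEmbedding (S.C.domRestrict (w.foldr S.f)) := by
      have : CompactSpace S.C := isCompact_iff_compactSpace.1 S.isCompact_C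
      exact (((S.foldr_continuous w).comp continuous_subtype_val).isClosedEmbedding
        fun x y h => Subtype.ext (S.foldr_injective w h)).isEmbedding
    have : IsTotallyDisconnected (range (S.C.domRestrict (w.foldr S.f))) := by
      rw [hemb.isTotallyDisconnected_range]
      exact totallyDisconnectedSpace_subtype_iff.2 hC
    rw [range_domRestrict] at this
    exact this t hw ht
  · intro x hx y hy
    by_contra hxy
    obtain ⟨m, hm⟩ := S.shrink (dist x y) (dist_pos.2 hxy)
    obtain ⟨w, hwm, hw⟩ := (S.isPreconnected_subset_word ht htA hne m).resolve_left h
    obtain ⟨x, hx', rfl⟩ := hw hx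
    obtain ⟨y, hy', rfl⟩ := hw hy
    exact lt_irrefl _ (hm w hwm x (S.attractor_subset hx') y (S.attractor_subset hy'))

lemma attractor_perfect [Nontrivial J] (hne : S.attractor.Nonempty)
    (hC : ∀ x ∈ S.C, ∀ U ∈ 𝓝 x, ∃ y ∈ S.C, y ∈ U ∧ y ≠ x) {x : E} (hx : x ∈ S.attractor)
    {U : Set E} (hU : U ∈ 𝓝 x) : ∃ y ∈ S.attractor, y ∈ U ∧ y ≠ x := by
  rcases S.exists_copy hx with ⟨w, y, hy, rfl⟩ | h
  · obtain ⟨z, hz, hzU, hzy⟩ := hC y hy _ ((S.foldr_continuous w).continuousAt.preimage_mem_nhds hU)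
    exact ⟨_, S.foldr_attractor w (S.C_subset_attractor hz), hzU,
      fun h => hzy (S.foldr_injective w h)⟩
  · obtain ⟨w, ⟨y, hy, rfl⟩, hw⟩ := h U hU
    obtain ⟨p, hp⟩ := hne
    obtain ⟨i, j, hij⟩ := exists_pair_ne J
    obtain ⟨z, hz, hzy⟩ : ∃ z ∈ S.attractor, z ≠ y := by
      by_contra! h
      apply hij
      apply S.disjoint _ _ _ (S.attractor_subset hp) _ (S.attractor_subset hp)
      rw [h _ (S.map_attractor hp), h _ (S.map_attractor hp)]
    exact ⟨_, S.foldr_attractor w hz, hw z hz, fun h => hzy (S.foldr_injective w h)⟩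

end CondensedIFS

end Attractor

section Tubes

open Real

/-- An odd open embedding of the line in a short interval. -/
def kap (x : ℝ) : ℝ := arctan x / 16

/-- The radius of the torus swept at height `z`. -/
def rad (z : ℝ) : ℝ := 5 / 2 + kap z

lemma kap_strictMono : StrictMono kap := fun x y h =>
  div_lt_div_of_pos_right (arctan_strictMono h) (by norm_num)

lemma kap_zero : kap 0 = 0 := by simp [kap]

lemma kap_neg_iff {x : ℝ} : kap x < 0 ↔ x < 0 := by
  rw [← kap_zero, kap_strictMono.lt_iff_lt, kap_zero]

lemma kap_nonneg_iff {x : ℝ} : 0 ≤ kap x ↔ 0 ≤ x := by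
  rw [← not_lt, kap_neg_iff, not_lt]

lemma abs_kap_lt (x : ℝ) : |kap x| < 1 / 10 := by
  have h1 := arctan_lt_pi_div_two x
  have h2 := neg_pi_div_two_lt_arctan x
  have := pi_lt_d2
  rw [abs_lt, kap]
  constructor <;> linarith

lemma abs_kap_sub_le (x y : ℝ) : |kap x - kap y| ≤ |x - y| / 16 := by
  have : |arctan x - arctan y| ≤ 1 * |x - y| := by
    refine Convex.norm_image_sub_le_of_norm_deriv_le (𝕜 := ℝ) (f := arctan) (s := univ)
      (fun x _ => differentiable_arctan x) (fun x _ => ?_) convex_univ (mem_univ y) (mem_univ x)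
    rw [Real.deriv_arctan, norm_eq_abs, abs_of_nonneg (by positivity)]
    exact div_le_one_of_le₀ (by nlinarith [sq_nonneg x]) (by positivity)
  rw [kap, kap, ← sub_div, abs_div, abs_of_pos (by norm_num : (0 : ℝ) < 16)]
  linarith

lemma continuous_kap : Continuous kap := continuous_arctan.div_const _

lemma isOpenMap_kap_div (c : ℝ) (hc : 0 < c) : IsOpenMap fun x => kap x / c := by
  refine isOpenMap_of_hasStrictDerivAt (f' := fun x => 1 / (1 + x ^ 2) / 16 / c)
    (fun x => ((hasStrictDerivAt_arctan x).div_const 16).div_const c) fun x => ?_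
  have : 0 < 1 + x ^ 2 := by positivity
  positivity

lemma rad_gt (z : ℝ) : 12 / 5 < rad z := by
  have := (abs_lt.1 (abs_kap_lt z)).1
  unfold rad; linarith

lemma rad_lt (z : ℝ) : rad z < 13 / 5 := by
  have := (abs_lt.1 (abs_kap_lt z)).2
  unfold rad; linarith

lemma rad_pos (z : ℝ) : 0 < rad z := by linarith [rad_gt z]

lemma rad_lt_iff {z : ℝ} : rad z < 5 / 2 ↔ z < 0 := by
  rw [← kap_neg_iff, rad]; constructor <;> intro h <;> linarith

lemma rad_zero : rad 0 = 5 / 2 := by simp [rad, kap_zero]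

lemma continuous_rad : Continuous rad := continuous_const.add continuous_kap

lemma isOpenMap_log_rad : IsOpenMap fun z => log (rad z) := by
  refine isOpenMap_of_hasStrictDerivAt (f' := fun x => (rad x)⁻¹ * (1 / (1 + x ^ 2) / 16))
    (fun x => ?_) fun x => ?_
  · have h1 : HasStrictDerivAt rad (1 / (1 + x ^ 2) / 16) x :=
      ((hasStrictDerivAt_arctan x).div_const 16).const_add (5 / 2)
    exact (hasStrictDerivAt_log (rad_pos x).ne').comp x h1
  · have := rad_pos x
    have : 0 < 1 + x ^ 2 := by positivity
    positivity

/-- Polar coordinates, with logarithmic radius. -/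
def polar (p : Circle × ℝ) : ℂ := (Real.exp p.2 : ℝ) * (p.1 : ℂ)

lemma continuous_polar : Continuous polar := by
  unfold polar
  exact (Complex.continuous_ofReal.comp (Real.continuous_exp.comp continuous_snd)).mul
    (continuous_subtype_val.comp continuous_fst)

lemma isOpenMap_polar : IsOpenMap polar := by
  have hs : Function.Surjective fun w : ℂ => ((Circle.exp w.im, w.re) : Circle × ℝ) :=
    fun ⟨u, t⟩ => ⟨⟨t, Complex.arg u⟩, by simp⟩
  have hc : Continuous fun w : ℂ => ((Circle.exp w.im, w.re) : Circle × ℝ) :=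
    (Circle.exp.continuous.comp Complex.continuous_im).prodMk Complex.continuous_re
  intro U hU
  rw [← image_preimage_eq U hs, ← image_comp]
  suffices h : IsOpenMap (polar ∘ fun w : ℂ => ((Circle.exp w.im, w.re) : Circle × ℝ)) from
    h _ (hU.preimage hc)
  have : (polar ∘ fun w : ℂ => ((Circle.exp w.im, w.re) : Circle × ℝ)) = Complex.exp := by
    ext w
    simp only [polar, Function.comp, Circle.coe_exp, Complex.ofReal_exp, ← Complex.exp_add]
    rw [Complex.re_add_im]
  rw [this]
  exact Complex.isOpenMap_exp

lemma polar_injective : Function.Injective polar := by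
  rintro ⟨u, t⟩ ⟨v, s⟩ h
  have hn : Real.exp t = Real.exp s := by
    simpa only [polar, norm_mul, Circle.norm_coe, mul_one, Complex.norm_real, Real.norm_eq_abs,
      Real.abs_exp] using congrArg norm h
  obtain rfl := Real.exp_injective hn
  have : (u : ℂ) = v := by
    have h0 : ((Real.exp t : ℝ) : ℂ) ≠ 0 := by exact_mod_cast (Real.exp_pos t).ne'
    exact mul_left_cancel₀ h0 h
  rw [Circle.ext this]

lemma isOpenEmbedding_polar : IsOpenEmbedding polar :=
  .of_continuous_injective_isOpenMap continuous_polar polar_injective isOpenMap_polar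

lemma abs_re_le (u : Circle) : |(u : ℂ).re| ≤ 1 := by
  simpa only [Circle.norm_coe] using Complex.abs_re_le_norm (u : ℂ)

lemma abs_im_le (u : Circle) : |(u : ℂ).im| ≤ 1 := by
  simpa only [Circle.norm_coe] using Complex.abs_im_le_norm (u : ℂ)

lemma re_sq_add_im_sq (u : Circle) : (u : ℂ).re ^ 2 + (u : ℂ).im ^ 2 = 1 := by
  have := Circle.normSq_coe u
  rw [Complex.normSq_apply] at this
  nlinarith

/-- The pair whose coordinate singled out by `b` is `m` and whose other coordinate is `o`. -/
def pack (b : Bool) (v : ℝ × ℝ) : ℝ × ℝ := if b then v else v.swap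

lemma pack_pack (b : Bool) (v : ℝ × ℝ) : pack b (pack b v) = v := by
  cases b <;> rfl

lemma pack_not (b : Bool) (v : ℝ × ℝ) : pack (!b) v = (pack b v).swap := by
  cases b <;> rfl

lemma continuous_pack (b : Bool) : Continuous (pack b) := by
  cases b
  exacts [continuous_swap, continuous_id]

lemma isOpenMap_pack (b : Bool) : IsOpenMap (pack b) := by
  cases b
  exacts [(Homeomorph.prodComm ℝ ℝ).isOpenMap, IsOpenMap.id]

/-- The sign attached to a parity. -/
def sgn (b : Bool) : Circle := if b then 1 else -1

lemma sgn_mul_self (b : Bool) : sgn b * sgn b = 1 := by cases b <;> simp [sgn]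

lemma sgn_not (b : Bool) : sgn (!b) = -sgn b := by cases b <;> simp [sgn]

/-- The solid torus of parity `b` centred at the angle `ω`. -/
def tube (l : ℕ) (b : Bool) (ω : Circle) (p : Circle × ℝ × ℝ) : Circle × ℝ × ℝ :=
  (ω * Circle.exp (rad p.2.2 * (p.1 : ℂ).re / l),
    pack b (rad p.2.2 * (p.1 : ℂ).im / 10, kap p.2.1 / 10))

lemma continuous_tube (l : ℕ) (b : Bool) (ω : Circle) : Continuous (tube l b ω) := by
  have hr := continuous_rad
  have hk := continuous_kap
  have hu : Continuous fun p : Circle × ℝ × ℝ => (p.1 : ℂ) := by fun_prop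
  have h1 : Continuous fun p : Circle × ℝ × ℝ => rad p.2.2 * (p.1 : ℂ).re / l := by fun_prop
  have h2 : Continuous fun p : Circle × ℝ × ℝ => rad p.2.2 * (p.1 : ℂ).im / 10 := by fun_prop
  have h3 : Continuous fun p : Circle × ℝ × ℝ => kap p.2.1 / 10 := by fun_prop
  exact (continuous_const.mul (Circle.exp.continuous.comp h1)).prodMk
    ((continuous_pack b).comp (h2.prodMk h3))

lemma polar_log_rad (u : Circle) (z : ℝ) : polar (u, log (rad z)) = (rad z : ℂ) * u := by
  simp only [polar, exp_log (rad_pos z)]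

lemma isOpenMap_tube {l : ℕ} (hl : 0 < l) (b : Bool) (ω : Circle) : IsOpenMap (tube l b ω) := by
  have hl' : (0 : ℝ) < l := by exact_mod_cast hl
  have h1 : IsOpenMap fun p : Circle × ℝ × ℝ => (polar (p.1, log (rad p.2.2)), kap p.2.1 / 10) := by
    have e := (((Homeomorph.refl Circle).prodCongr (Homeomorph.prodComm ℝ ℝ)).trans
      (Homeomorph.prodAssoc Circle ℝ ℝ).symm).isOpenMap
    exact (isOpenMap_polar.prodMap (isOpenMap_kap_div 10 (by norm_num))).comp
      (((IsOpenMap.id.prodMap isOpenMap_log_rad).prodMap IsOpenMap.id).comp e)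
  have hdiv : ∀ c : ℝ, 0 < c → IsOpenMap fun x : ℝ => x / c := fun c hc => by
    simp only [div_eq_mul_inv]
    exact (Homeomorph.mulRight₀ c⁻¹ (inv_ne_zero hc.ne')).isOpenMap
  have h2 : IsOpenMap fun q : ℂ × ℝ => (ω * Circle.exp (q.1.re / l), pack b (q.1.im / 10, q.2)) := by
    have hg : IsOpenMap fun x : ℝ => ω * Circle.exp (x / l) :=
      (Homeomorph.mulLeft ω).isOpenMap.comp
        (isLocalHomeomorph_circleExp.isOpenMap.comp (hdiv l hl'))
    have e := (((Complex.equivRealProdCLM.toHomeomorph).prodCongr (Homeomorph.refl ℝ)).trans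
      (Homeomorph.prodAssoc ℝ ℝ ℝ)).isOpenMap
    exact (hg.prodMap ((isOpenMap_pack b).comp
      ((hdiv 10 (by norm_num)).prodMap IsOpenMap.id))).comp e
  convert! h2.comp h1 using 1
  ext p : 1
  simp only [tube, Function.comp, polar_log_rad, Complex.re_ofReal_mul, Complex.im_ofReal_mul]

/-- Angular distance of `u ^ l` to the sign of parity `b`. -/
def ang (l : ℕ) (b : Bool) (u : Circle) : ℝ := arccos ((sgn b * u ^ l : Circle) : ℂ).re

lemma continuous_ang (l : ℕ) (b : Bool) : Continuous (ang l b) := by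
  unfold ang
  have : Continuous fun u : Circle => sgn b * u ^ l := by fun_prop
  exact continuous_arccos.comp (Complex.continuous_re.comp (continuous_subtype_val.comp this))

lemma ang_nonneg (l : ℕ) (b : Bool) (u : Circle) : 0 ≤ ang l b u := arccos_nonneg _

lemma ang_not (l : ℕ) (b : Bool) (u : Circle) : ang l (!b) u = π - ang l b u := by
  unfold ang
  rw [sgn_not, neg_mul, Circle.coe_neg, Complex.neg_re, arccos_neg]

lemma sgn_mul_pow_tube {l : ℕ} (hl : 0 < l) {b : Bool} {ω : Circle} (hω : ω ^ l = sgn b) (t : ℝ) :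
    sgn b * (ω * Circle.exp (t / l)) ^ l = Circle.exp t := by
  have hl' : (l : ℝ) ≠ 0 := by exact_mod_cast hl.ne'
  rw [mul_pow, hω, ← mul_assoc, sgn_mul_self, one_mul, ← Circle.exp_natCast_mul,
    mul_div_cancel₀ _ hl']

lemma ang_tube {l : ℕ} (hl : 0 < l) {b : Bool} {ω : Circle} (hω : ω ^ l = sgn b) {t : ℝ}
    (ht : |t| ≤ π) : ang l b (ω * Circle.exp (t / l)) = |t| := by
  rw [ang, sgn_mul_pow_tube hl hω, Circle.coe_exp, Complex.exp_ofReal_mul_I_re, ← cos_abs,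
    arccos_cos (abs_nonneg t) ht]

lemma abs_rad_mul_re_lt (u : Circle) (z : ℝ) : |rad z * (u : ℂ).re| < π := by
  have := abs_re_le u
  have h1 := rad_lt z
  have h2 := rad_pos z
  have := pi_gt_three
  rw [abs_mul, abs_of_pos h2]
  nlinarith

lemma abs_rad_mul_im_le (u : Circle) (z : ℝ) : |rad z * (u : ℂ).im / 10| ≤ 13 / 50 := by
  have := abs_im_le u
  have h1 := rad_lt z
  have h2 := rad_pos z
  rw [abs_div, abs_mul, abs_of_pos h2, abs_of_pos (by norm_num : (0 : ℝ) < 10)]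
  nlinarith [abs_nonneg (u : ℂ).im]

lemma tube_injective {l : ℕ} (hl : 0 < l) {b : Bool} {ω ω' : Circle} (hω : ω ^ l = sgn b)
    (hω' : ω' ^ l = sgn b) {p q : Circle × ℝ × ℝ} (h : tube l b ω p = tube l b ω' q) :
    ω = ω' ∧ p = q := by
  obtain ⟨u, y, z⟩ := p
  obtain ⟨v, y', z'⟩ := q
  have h1 := congrArg Prod.fst h
  have h2 := congrArg Prod.snd h
  simp only [tube] at h1 h2
  have h3 := congrArg (pack b) h2
  simp only [pack_pack, Prod.mk.injEq] at h3
  have h4 : rad z * (u : ℂ).re = rad z' * (v : ℂ).re := by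
    have := congrArg (fun w => sgn b * w ^ l) h1
    simp only [sgn_mul_pow_tube hl hω, sgn_mul_pow_tube hl hω'] at this
    refine Circle.exp_injOn_Ioc (a := -π) (b := π) (by linarith) ?_ ?_ this
    · have := abs_lt.1 (abs_rad_mul_re_lt u z)
      exact ⟨this.1, this.2.le⟩
    · have := abs_lt.1 (abs_rad_mul_re_lt v z')
      exact ⟨this.1, this.2.le⟩
  have h5 : polar (u, log (rad z)) = polar (v, log (rad z')) := by
    rw [polar_log_rad, polar_log_rad]
    apply Complex.ext
    · simpa using h4
    · have := h3.1
      simp only [Complex.im_ofReal_mul]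
      linarith
  have h6 := polar_injective h5
  simp only [Prod.mk.injEq] at h6
  obtain ⟨rfl, h6⟩ := h6
  have h7 : z = z' := by
    have := log_injOn_pos (rad_pos z) (rad_pos z') h6
    exact kap_strictMono.injective (by simpa [rad] using this)
  have h8 : y = y' := kap_strictMono.injective (by linarith [h3.2])
  subst h7 h8
  exact ⟨mul_right_cancel h1, rfl⟩

/-- The square of the radius in the plane spanned by the angular coordinate and the height. -/
def gau (l : ℕ) (b : Bool) (p : Circle × ℝ × ℝ) : ℝ :=
  ang l b p.1 ^ 2 + (10 * (pack b p.2).1) ^ 2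

lemma continuous_gau (l : ℕ) (b : Bool) : Continuous (gau l b) := by
  have h1 : Continuous fun p : Circle × ℝ × ℝ => ang l b p.1 := (continuous_ang l b).comp continuous_fst
  have h2 : Continuous fun p : Circle × ℝ × ℝ => (pack b p.2).1 :=
    continuous_fst.comp ((continuous_pack b).comp continuous_snd)
  unfold gau
  fun_prop

lemma gau_tube {l : ℕ} (hl : 0 < l) {b : Bool} {ω : Circle} (hω : ω ^ l = sgn b)
    (p : Circle × ℝ × ℝ) : gau l b (tube l b ω p) = rad p.2.2 ^ 2 := by
  simp only [gau, tube, ang_tube hl hω (abs_rad_mul_re_lt _ _).le, sq_abs, pack_pack]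
  have := re_sq_add_im_sq p.1
  linear_combination rad p.2.2 ^ 2 * this

lemma gau_tube_lt_iff {l : ℕ} (hl : 0 < l) {b : Bool} {ω : Circle} (hω : ω ^ l = sgn b)
    (p : Circle × ℝ × ℝ) : gau l b (tube l b ω p) < (5 / 2) ^ 2 ↔ p.2.2 < 0 := by
  rw [gau_tube hl hω, sq_lt_sq₀ (rad_pos _).le (by norm_num), rad_lt_iff]

lemma gau_not_tube_lt {l : ℕ} (hl : 0 < l) {b : Bool} {ω : Circle} (hω : ω ^ l = sgn b)
    {p : Circle × ℝ × ℝ} (hp : (pack b (tube l b ω p).2).1 = 0) :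
    gau l (!b) (tube l b ω p) < (5 / 2) ^ 2 := by
  have h1 := gau_tube hl hω p
  rw [gau, hp] at h1
  have h2 : ang l b (tube l b ω p).1 = rad p.2.2 := by
    have : ang l b (tube l b ω p).1 ^ 2 = rad p.2.2 ^ 2 := by linarith
    exact (sq_eq_sq₀ (ang_nonneg _ _ _) (rad_pos _).le).1 this
  have h3 : (pack (!b) (tube l b ω p).2).1 = kap p.2.1 / 10 := by
    simp only [tube, pack_not, pack_pack, Prod.swap]
  rw [gau, ang_not, h2, h3]
  have h4 := rad_gt p.2.2
  have h5 := rad_lt p.2.2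
  have h6 := abs_lt.1 (abs_kap_lt p.2.1)
  have h7 := pi_lt_d2
  have h8 := pi_gt_three
  have h9 : (π - rad p.2.2) ^ 2 < 1 := by nlinarith
  have h10 : (10 * (kap p.2.1 / 10)) ^ 2 < 1 := by nlinarith [h6.1, h6.2]
  linarith

lemma exists_of_gau_eq {l : ℕ} (hl : 0 < l) {b : Bool} {p : Circle × ℝ × ℝ}
    (h : gau l b p = (5 / 2) ^ 2) (hp : (pack b p.2).2 = 0) :
    ∃ ω u, ω ^ l = sgn b ∧ p = tube l b ω (u, 0, 0) := by
  have hl' : (l : ℝ) ≠ 0 := by exact_mod_cast hl.ne'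
  obtain ⟨θ, hθ, hθ'⟩ : ∃ θ : ℝ, sgn b * p.1 ^ l = Circle.exp θ ∧ |θ| = ang l b p.1 := by
    refine ⟨Complex.arg ((sgn b * p.1 ^ l : Circle) : ℂ), by rw [Circle.exp_arg], ?_⟩
    rw [ang]
    conv_rhs => rw [← Circle.exp_arg (sgn b * p.1 ^ l)]
    rw [Circle.coe_exp, Complex.exp_ofReal_mul_I_re, ← cos_abs, arccos_cos (abs_nonneg _)
      (Complex.abs_arg_le_pi _)]
  have hsq : (2 / 5 * θ) ^ 2 + (4 * (pack b p.2).1) ^ 2 = 1 := by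
    rw [gau, ← hθ', sq_abs] at h
    linear_combination (4 / 25 : ℝ) * h
  let u : Circle := ⟨⟨2 / 5 * θ, 4 * (pack b p.2).1⟩, by
    rw [Submonoid.unitSphere, Submonoid.mem_mk]
    show _ ∈ sphere (0 : ℂ) 1
    rw [mem_sphere_zero_iff_norm, ← sq_eq_sq₀ (norm_nonneg _) zero_le_one, Complex.sq_norm,
      Complex.normSq_apply]
    linarith⟩
  refine ⟨p.1 * Circle.exp (-(θ / l)), u, ?_, ?_⟩
  · rw [mul_pow, ← Circle.exp_natCast_mul, mul_neg, mul_div_cancel₀ _ hl', Circle.exp_neg, ← hθ,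
      mul_inv_rev, mul_comm (p.1 ^ l)⁻¹, mul_left_comm, mul_inv_cancel, mul_one,
      inv_eq_of_mul_eq_one_left (sgn_mul_self b)]
  · have h1 : rad 0 * (u : ℂ).re / l = θ / l := by
      show rad 0 * (2 / 5 * θ) / l = _
      rw [rad_zero]; ring
    have h2 : rad 0 * (u : ℂ).im / 10 = (pack b p.2).1 := by
      show rad 0 * (4 * (pack b p.2).1) / 10 = _
      rw [rad_zero]; ring
    ext1
    · simp only [tube, h1, Circle.exp_neg, inv_mul_cancel_right]
    · simp only [tube, h2, kap_zero, zero_div]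
      rw [← hp, Prod.mk.eta, pack_pack]

lemma gau_axis (l : ℕ) {p : Circle × ℝ × ℝ} (hp : p.2 = 0) :
    gau l true p < (5 / 2) ^ 2 ∨ gau l false p < (5 / 2) ^ 2 := by
  have h1 := ang_not l true p.1
  have h2 := ang_nonneg l true p.1
  have h3 := ang_nonneg l false p.1
  have h4 := pi_lt_d2
  simp only [Bool.not_true] at h1
  simp only [gau, hp, pack]
  by_contra! h
  simp only [if_true, Prod.fst_zero, mul_zero, Bool.false_eq_true, if_false, Prod.fst_swap,
    Prod.snd_zero] at h
  nlinarith [h.1, h.2]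

lemma tube_disjoint {l : ℕ} (hl : 0 < l) {b : Bool} {ω ω' : Circle} (hω : ω ^ l = sgn b)
    (hω' : ω' ^ l = sgn (!b)) (p q : Circle × ℝ × ℝ) : tube l b ω p ≠ tube l (!b) ω' q := by
  intro h
  have h1 := gau_tube hl hω p
  have h2 := gau_tube hl hω' q
  have h3 : (pack b (tube l b ω p).2).1 = kap q.2.1 / 10 := by
    rw [h]; simp only [tube, pack_not, Prod.swap]
    cases b <;> rfl
  have h4 : (pack (!b) (tube l (!b) ω' q).2).1 = kap p.2.1 / 10 := by
    rw [← h]; simp only [tube, pack_not, Prod.swap, pack_pack]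
  rw [gau, h4, ← h, ang_not] at h2
  rw [gau, h3] at h1
  have h5 := ang_nonneg l b (tube l b ω p).1
  have h6 := ang_nonneg l (!b) (tube l b ω p).1
  rw [ang_not] at h6
  have h7 := rad_gt p.2.2
  have h8 := rad_gt q.2.2
  have h9 := pi_lt_d2
  have h10 := abs_lt.1 (abs_kap_lt p.2.1)
  have h11 := abs_lt.1 (abs_kap_lt q.2.1)
  have h12 : (10 * (kap q.2.1 / 10)) ^ 2 < 1 := by nlinarith [h11.1, h11.2]
  have h13 : (10 * (kap p.2.1 / 10)) ^ 2 < 1 := by nlinarith [h10.1, h10.2]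
  have h14 : 2 < ang l b (tube l b ω p).1 := by nlinarith
  have h15 : 2 < π - ang l b (tube l b ω p).1 := by nlinarith
  linarith

end Tubes

section Necklace

open Quadrant

/-- The product of a torus and a plane. -/
abbrev Tor (k : ℕ) := (Fin (k + 1) → Circle) × ℝ × ℝ

variable {k : ℕ}

/-- Splitting off the first angle. -/
def splitHead (k : ℕ) : Tor k ≃ₜ (Fin k → Circle) × Circle × ℝ × ℝ where
  toFun p := (Fin.tail p.1, p.1 0, p.2)
  invFun q := (Fin.cons q.2.1 q.1, q.2.2)
  left_inv p := by simp
  right_inv q := by simp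
  continuous_toFun := continuous_fst.finTail.prodMk
    (((continuous_apply 0).comp continuous_fst).prodMk continuous_snd)
  continuous_invFun := (Continuous.finCons (A := fun _ => Circle)
    (continuous_fst.comp continuous_snd) continuous_fst).prodMk (continuous_snd.comp continuous_snd)

/-- Splitting off the last angle. -/
def splitLast (k : ℕ) : Tor k ≃ₜ (Fin k → Circle) × Circle × ℝ × ℝ where
  toFun p := (Fin.init p.1, p.1 (Fin.last k), p.2)
  invFun q := (Fin.snoc (α := fun _ => Circle) q.1 q.2.1, q.2.2)
  left_inv p := by simp
  right_inv q := by simp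
  continuous_toFun := continuous_fst.finInit.prodMk
    (((continuous_apply _).comp continuous_fst).prodMk continuous_snd)
  continuous_invFun := (Continuous.finSnoc (A := fun _ => Circle) continuous_fst
    (continuous_fst.comp continuous_snd)).prodMk (continuous_snd.comp continuous_snd)

/-- The number of tubes of each parity. -/
def len (k : ℕ) : ℕ := 8 * 2 ^ k

lemma len_pos (k : ℕ) : 0 < len k := by unfold len; positivity

/-- The index set of the tubes: centres with their parities. -/
abbrev Idx (k : ℕ) := {p : Circle × Bool // p.1 ^ len k = sgn p.2}

instance finite_idx (k : ℕ) : Finite (Idx k) := by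
  have h : ∀ b, {u : Circle | u ^ len k = sgn b}.Finite := fun b => by
    refine Finite.of_finite_image (f := fun u : Circle => (u : ℂ)) ?_
      (Circle.coe_injective.injOn)
    refine (Polynomial.nthRoots (len k) ((sgn b : Circle) : ℂ)).toFinset.finite_toSet.subset ?_
    rintro _ ⟨u, hu, rfl⟩
    have hu : u ^ len k = sgn b := hu
    rw [Finset.mem_coe, Multiset.mem_toFinset, Polynomial.mem_nthRoots (len_pos k), ← hu,
      Circle.coe_pow]
  refine Set.Finite.to_subtype (s := {p : Circle × Bool | p.1 ^ len k = sgn p.2}) ?_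
  refine (((h true).prod finite_univ).union ((h false).prod finite_univ)).subset ?_
  rintro ⟨u, b⟩ hu
  cases b
  exacts [Or.inr ⟨hu, mem_univ _⟩, Or.inl ⟨hu, mem_univ _⟩]

lemma exists_idx (k : ℕ) (b : Bool) : ∃ j : Idx k, j.1.2 = b := by
  have hl : ((len k : ℕ) : ℝ) ≠ 0 := by exact_mod_cast (len_pos k).ne'
  obtain ⟨θ, hθ⟩ : ∃ θ : ℝ, Circle.exp θ = sgn b :=
    ⟨Complex.arg (sgn b : Circle), Circle.exp_arg _⟩
  refine ⟨⟨(Circle.exp (θ / len k), b), ?_⟩, rfl⟩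
  show Circle.exp (θ / len k) ^ len k = sgn b
  rw [← Circle.exp_natCast_mul, mul_div_cancel₀ _ hl, hθ]

instance nontrivial_idx (k : ℕ) : Nontrivial (Idx k) := by
  obtain ⟨i, hi⟩ := exists_idx k true
  obtain ⟨j, hj⟩ := exists_idx k false
  exact ⟨i, j, fun h => by simp [h, hj] at hi⟩

/-- The embedding of the tube with index `j`. -/
def link (j : Idx k) (p : Tor k) : Tor k :=
  (splitLast k).symm (Prod.map id (tube (len k) j.1.2 j.1.1) (splitHead k p))

lemma splitLast_link (j : Idx k) (p : Tor k) :
    splitLast k (link j p) = Prod.map id (tube (len k) j.1.2 j.1.1) (splitHead k p) := by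
  simp [link]

lemma link_injective (j : Idx k) : Function.Injective (link j) :=
  (splitLast k).symm.injective.comp ((Function.injective_id.prodMap fun _ _ h =>
    (tube_injective (len_pos k) j.2 j.2 h).2).comp (splitHead k).injective)

lemma continuous_link (j : Idx k) : Continuous (link j) :=
  (splitLast k).symm.continuous.comp
    ((continuous_id.prodMap (continuous_tube _ _ _)).comp (splitHead k).continuous)

lemma isOpenEmbedding_link (j : Idx k) : IsOpenEmbedding (link j) :=
  .of_continuous_injective_isOpenMap (continuous_link j) (link_injective j)
    ((splitLast k).symm.isOpenMap.comp
      ((IsOpenMap.id.prodMap (isOpenMap_tube (len_pos k) _ _)).comp (splitHead k).isOpenMap))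

lemma link_disjoint (i j : Idx k) (p q : Tor k) (h : link i p = link j q) : i = j := by
  have h1 : tube (len k) i.1.2 i.1.1 (splitHead k p).2 =
      tube (len k) j.1.2 j.1.1 (splitHead k q).2 := by
    have := congrArg (fun r => (splitLast k r).2) h
    simpa only [splitLast_link, Prod.map_snd] using this
  obtain ⟨⟨ω, b⟩, hi⟩ := i
  obtain ⟨⟨ω', b'⟩, hj⟩ := j
  by_cases hb : b' = b
  · subst hb
    obtain ⟨rfl, -⟩ := tube_injective (len_pos k) hi hj h1
    rfl
  · obtain rfl : b' = !b := by cases b <;> cases b' <;> simp_all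
    exact absurd h1 (tube_disjoint (len_pos k) hi hj _ _)

/-- The closed solid torus. -/
def solid (k : ℕ) : Set (Tor k) := univ ×ˢ Icc (-1) 1 ×ˢ Icc (-1) 1

lemma isCompact_solid : IsCompact (solid k) := isCompact_univ.prod (isCompact_Icc.prod isCompact_Icc)

lemma mem_solid {p : Tor k} : p ∈ solid k ↔ |p.2.1| ≤ 1 ∧ |p.2.2| ≤ 1 := by
  simp only [solid, mem_prod, mem_univ, true_and, mem_Icc, abs_le]

lemma abs_link_le (j : Idx k) (p : Tor k) : |(link j p).2.1| ≤ 1 ∧ |(link j p).2.2| ≤ 1 := by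
  have h1 := abs_rad_mul_im_le (p.1 0) p.2.2
  have h2 : |kap p.2.1 / 10| ≤ 1 := by
    have := abs_kap_lt p.2.1
    rw [abs_div, abs_of_pos (by norm_num : (0 : ℝ) < 10)]
    linarith
  obtain ⟨⟨ω, b⟩, hj⟩ := j
  cases b
  exacts [⟨h2, by dsimp [link, tube, pack, splitHead, splitLast]; linarith⟩,
    ⟨by dsimp [link, tube, pack, splitHead, splitLast]; linarith, h2⟩]

lemma link_mem_solid (j : Idx k) (p : Tor k) : link j p ∈ solid k := mem_solid.2 (abs_link_le j p)

/-- Closeness with a geometric weight on the angles. -/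
def Near (ε : ℝ) (p q : Tor k) : Prop :=
  (∀ i, dist (p.1 i) (q.1 i) ≤ ε / 2 ^ (i : ℕ)) ∧ |p.2.1 - q.2.1| ≤ ε ∧ |p.2.2 - q.2.2| ≤ ε

lemma circle_dist (u v : Circle) : dist u v = ‖(u : ℂ) - v‖ := Complex.dist_eq _ _

lemma dist_mul_exp_le (u : Circle) (x y : ℝ) :
    dist (u * Circle.exp x) (u * Circle.exp y) ≤ |x - y| := by
  have h : ((u * Circle.exp x : Circle) : ℂ) - ((u * Circle.exp y : Circle) : ℂ) =
      u * Circle.exp y * (Complex.exp (Complex.I * (x - y : ℝ)) - 1) := by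
    have : x = y + (x - y) := by ring
    rw [Circle.coe_mul, Circle.coe_mul]
    conv_lhs => rw [this, Circle.exp_add, Circle.coe_mul]
    rw [Circle.coe_exp (x - y), mul_comm Complex.I]
    ring
  rw [circle_dist, h, norm_mul, norm_mul, Circle.norm_coe, Circle.norm_coe, one_mul, one_mul]
  exact Real.norm_exp_I_mul_ofReal_sub_one_le

lemma abs_rad_mul_sub_le {z z' a a' ε : ℝ} (hz : |z - z'| ≤ ε) (ha : |a - a'| ≤ ε) (ha1 : |a| ≤ 1) :
    |rad z * a - rad z' * a'| ≤ 4 * ε := by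
  have h1 : rad z * a - rad z' * a' = (kap z - kap z') * a + rad z' * (a - a') := by
    unfold rad; ring
  have h2 := abs_kap_sub_le z z'
  have h3 := rad_lt z'
  rw [h1]
  refine (abs_add_le _ _).trans ?_
  rw [abs_mul, abs_mul, abs_of_pos (rad_pos z')]
  have h4 : |kap z - kap z'| * |a| ≤ ε / 16 :=
    (mul_le_of_le_one_right (abs_nonneg _) ha1).trans (by linarith)
  have h5 : rad z' * |a - a'| ≤ 13 / 5 * ε := by
    have := abs_nonneg (a - a')
    have := rad_pos z'
    nlinarith
  linarith [(abs_nonneg _).trans ha]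

lemma Near.link {ε : ℝ} {p q : Tor k} (h : Near ε p q) (j : Idx k) :
    Near (ε / 2) (link j p) (link j q) := by
  obtain ⟨h1, h2, h3⟩ := h
  have h0 : ‖(p.1 0 : ℂ) - q.1 0‖ ≤ ε := by simpa [circle_dist] using h1 0
  have hre : |(p.1 0 : ℂ).re - (q.1 0 : ℂ).re| ≤ ε := by
    rw [← Complex.sub_re]
    exact (Complex.abs_re_le_norm _).trans h0
  have him : |(p.1 0 : ℂ).im - (q.1 0 : ℂ).im| ≤ ε := by
    rw [← Complex.sub_im]
    exact (Complex.abs_im_le_norm _).trans h0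
  have hre' := abs_rad_mul_sub_le h3 hre (abs_re_le _)
  have him' := abs_rad_mul_sub_le h3 him (abs_im_le _)
  have hε : 0 ≤ ε := (abs_nonneg _).trans h2
  have hm : |rad p.2.2 * (p.1 0 : ℂ).im / 10 - rad q.2.2 * (q.1 0 : ℂ).im / 10| ≤ ε / 2 := by
    rw [← sub_div, abs_div, abs_of_pos (by norm_num : (0 : ℝ) < 10)]
    linarith
  have ho : |kap p.2.1 / 10 - kap q.2.1 / 10| ≤ ε / 2 := by
    have := abs_kap_sub_le p.2.1 q.2.1
    rw [← sub_div, abs_div, abs_of_pos (by norm_num : (0 : ℝ) < 10)]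
    linarith
  obtain ⟨⟨ω, b⟩, hj⟩ := j
  refine ⟨fun i => ?_, ?_⟩
  · induction i using Fin.lastCases with
    | last =>
      have : dist (ω * Circle.exp (rad p.2.2 * (p.1 0 : ℂ).re / len k))
          (ω * Circle.exp (rad q.2.2 * (q.1 0 : ℂ).re / len k)) ≤ ε / 2 / 2 ^ k := by
        refine (dist_mul_exp_le _ _ _).trans ?_
        have hl : (len k : ℝ) = 8 * 2 ^ k := by simp [len]
        have h2k : (0 : ℝ) < 2 ^ k := by positivity
        rw [← sub_div, hl, abs_div, abs_of_pos (by positivity : (0 : ℝ) < 8 * 2 ^ k),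
          div_le_div_iff₀ (by positivity) h2k]
        nlinarith
      simpa [_root_.link, splitLast, splitHead, tube] using this
    | cast i =>
      have := h1 i.succ
      rw [Fin.val_succ, pow_succ'] at this
      simpa [_root_.link, splitLast, splitHead, tube, Fin.tail, div_div] using this
  · cases b
    exacts [⟨ho, hm⟩, ⟨hm, ho⟩]

lemma near_of_mem_solid {p q : Tor k} (hp : p ∈ solid k) (hq : q ∈ solid k) :
    Near (2 * 2 ^ k) p q := by
  rw [mem_solid, abs_le, abs_le] at hp hq
  have h2 : (1 : ℝ) ≤ 2 ^ k := one_le_pow₀ (by norm_num)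
  refine ⟨fun i => ?_, abs_le.2 ⟨by linarith, by linarith⟩, abs_le.2 ⟨by linarith, by linarith⟩⟩
  have h3 : (2 : ℝ) ^ (i : ℕ) ≤ 2 ^ k := pow_le_pow_right₀ (by norm_num) (by omega)
  have h4 : dist (p.1 i) (q.1 i) ≤ 2 := by
    rw [circle_dist]
    refine (norm_sub_le _ _).trans ?_
    rw [Circle.norm_coe, Circle.norm_coe]; norm_num
  rw [le_div_iff₀ (by positivity)]
  nlinarith [dist_nonneg (x := p.1 i) (y := q.1 i)]

lemma Near.dist_le {ε : ℝ} {p q : Tor k} (h : Near ε p q) : dist p q ≤ ε := by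
  have hε : 0 ≤ ε := (abs_nonneg _).trans h.2.1
  refine max_le ((dist_pi_le_iff hε).2 fun i => (h.1 i).trans ?_) (max_le h.2.1 h.2.2)
  exact div_le_self hε (one_le_pow₀ (by norm_num))

lemma near_foldr {p q : Tor k} (hp : p ∈ solid k) (hq : q ∈ solid k) (w : List (Idx k)) :
    Near (2 * 2 ^ k / 2 ^ w.length) (w.foldr link p) (w.foldr link q) := by
  induction w with
  | nil => simpa using near_of_mem_solid hp hq
  | cons j w ih =>
    have := ih.link j
    rwa [div_div, ← pow_succ] at this

/-- The necklace iterated function system. -/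
def necklace (k : ℕ) : CondensedIFS (Tor k) (Idx k) where
  f := link
  B := solid k
  C := ∅
  continuous := continuous_link
  injective := link_injective
  isCompact := isCompact_solid
  isCompact_C := isCompact_empty
  mapsTo j p _ := link_mem_solid j p
  subset := empty_subset _
  disjoint i j p _ q _ h := link_disjoint i j p q h
  disjoint_C _ _ _ := notMem_empty _
  shrink ε hε := by
    obtain ⟨m, hm⟩ := exists_pow_lt_of_lt_one (div_pos hε (by positivity : (0 : ℝ) < 2 * 2 ^ k))
      (by norm_num : (1 / 2 : ℝ) < 1)
    refine ⟨m, fun w hw p hp q hq => (near_foldr hp hq w).dist_le.trans_lt ?_⟩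
    rw [lt_div_iff₀ (by positivity), one_div, inv_pow] at hm
    rw [hw, div_eq_mul_inv, mul_comm]
    exact hm

end Necklace

section Local

open Quadrant

variable {k : ℕ}

lemma eventually_decide_lt {X : Type*} [TopologicalSpace X] {f : X → ℝ} (hf : Continuous f) {c : ℝ}
    {x : X} (hx : f x ≠ c) : ∀ᶠ y in 𝓝 x, decide (f y < c) = decide (f x < c) := by
  rcases hx.lt_or_gt with h | h
  · filter_upwards [hf.continuousAt.eventually_lt continuousAt_const h] with y hy
    simp [h, hy]
  · filter_upwards [continuousAt_const.eventually_lt hf.continuousAt h] with y hy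
    simp only [h.not_gt, hy.not_gt]

lemma eventually_decide_nonneg {X : Type*} [TopologicalSpace X] {f : X → ℝ} (hf : Continuous f)
    {x : X} (hx : f x ≠ 0) : ∀ᶠ y in 𝓝 x, decide (0 ≤ f y) = decide (0 ≤ f x) := by
  filter_upwards [eventually_decide_lt hf hx] with y hy
  simpa [← not_lt] using hy

/-- The quadrant of a point of the plane. -/
def quad (v : ℝ × ℝ) : Bool × Bool := (decide (0 ≤ v.1), decide (0 ≤ v.2))

lemma eventually_quad_fst {p : Tor k} (hp : p.2.1 ≠ 0) :
    ∀ᶠ q : Tor k in 𝓝 p, (quad q.2).1 = (quad p.2).1 :=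
  eventually_decide_nonneg (continuous_fst.comp continuous_snd) hp

lemma eventually_quad_snd {p : Tor k} (hp : p.2.2 ≠ 0) :
    ∀ᶠ q : Tor k in 𝓝 p, (quad q.2).2 = (quad p.2).2 :=
  eventually_decide_nonneg (continuous_snd.comp continuous_snd) hp

/-- Whether a point is inside the spanning annuli of the tubes of parity `b`. -/
def inside (b : Bool) (p : Tor k) : Bool := decide (gau (len k) b (splitLast k p).2 < (5 / 2) ^ 2)

lemma continuous_gau_splitLast (b : Bool) :
    Continuous fun p : Tor k => gau (len k) b (splitLast k p).2 :=
  (continuous_gau _ b).comp (continuous_snd.comp (splitLast k).continuous)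

lemma splitLast_snd_snd (p : Tor k) : (splitLast k p).2.2 = p.2 := rfl

lemma splitHead_snd_snd (p : Tor k) : (splitHead k p).2.2 = p.2 := rfl

lemma eventually_inside {p : Tor k} (hp : p ∉ ⋃ j : Idx k, link j '' solid k) {b : Bool}
    (hb : (pack b p.2).2 = 0) : ∀ᶠ q in 𝓝 p, inside b q = inside b p := by
  refine eventually_decide_lt (continuous_gau_splitLast b) fun h => hp ?_
  obtain ⟨ω, u, hω, hu⟩ := exists_of_gau_eq (len_pos k) h hb
  refine mem_iUnion.2 ⟨⟨(ω, b), hω⟩, (splitHead k).symm ((splitLast k p).1, u, 0, 0), ?_, ?_⟩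
  · rw [mem_solid]; simp [splitHead]
  · rw [← (splitLast k).injective.eq_iff, splitLast_link, Homeomorph.apply_symm_apply]
    exact Prod.ext rfl hu.symm

lemma inside_link (j : Idx k) (p : Tor k) : inside j.1.2 (link j p) = !(quad p.2).2 := by
  have := gau_tube_lt_iff (len_pos k) j.2 (splitHead k p).2
  rw [splitHead_snd_snd] at this
  rw [inside, splitLast_link, Prod.map_snd, quad, ← decide_not]
  exact decide_eq_decide.2 (this.trans not_le.symm)

lemma inside_not_link (j : Idx k) {p : Tor k} (hp : (pack j.1.2 (link j p).2).1 = 0) :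
    inside (!j.1.2) (link j p) = true := by
  rw [inside, splitLast_link, Prod.map_snd, decide_eq_true_eq]
  refine gau_not_tube_lt (len_pos k) j.2 ?_
  rwa [← splitLast_snd_snd, splitLast_link] at hp

lemma quad_link (j : Idx k) (p : Tor k) : ∃ s : Bool,
    quad (link j p).2 = if j.1.2 then (s, (quad p.2).1) else ((quad p.2).1, s) := by
  have h : (link j p).2 = (tube (len k) j.1.2 j.1.1 (splitHead k p).2).2 := by
    rw [← splitLast_snd_snd, splitLast_link]; rfl
  have h1 : decide (0 ≤ kap p.2.1 / 10) = decide (0 ≤ p.2.1) :=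
    decide_eq_decide.2 (by rw [le_div_iff₀ (by norm_num), zero_mul, kap_nonneg_iff])
  rw [h]
  obtain ⟨⟨ω, b⟩, hj⟩ := j
  cases b
  exacts [⟨_, Prod.ext h1 rfl⟩, ⟨_, Prod.ext rfl h1⟩]

/-- The transport of the necklace. -/
def transport (q x : Tor k) : Gp := tr (inside true x) (inside false x) (quad q.2) (quad x.2)

lemma eventually_transport {x : Tor k} (hx : x ∉ ⋃ j : Idx k, link j '' solid k) :
    ∀ᶠ y in 𝓝 x, ∀ᶠ q in 𝓝 y, transport q x = transport q y * transport y x := by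
  by_cases h1 : x.2.1 = 0
  · have he : ∀ᶠ q in 𝓝 x, inside false q = inside false x := eventually_inside hx h1
    by_cases h2 : x.2.2 = 0
    · have ho : ∀ᶠ q in 𝓝 x, inside true q = inside true x := eventually_inside hx h2
      have hs : inside true x || inside false x := by
        rcases gau_axis (len k) (p := (splitLast k x).2) (Prod.ext h1 h2) with h | h
        · simp only [inside, h, decide_true, Bool.true_or]
        · simp only [inside, h, decide_true, Bool.or_true]
      filter_upwards [he, ho] with y hy hy'
      refine .of_forall fun q => ?_
      simp only [transport, hy, hy']
      exact tr_mul_of_state hs _ _ _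
    · filter_upwards [he, eventually_quad_snd h2, (eventually_quad_snd h2).eventually_nhds]
        with y hy hy' hyy
      filter_upwards [hyy] with q hq
      simp only [transport, hy]
      rw [← Prod.mk.eta (p := quad q.2), ← Prod.mk.eta (p := quad y.2),
        ← Prod.mk.eta (p := quad x.2), hq, hy', tr_fst_irrel (inside true y) (inside true x)]
      exact tr_mul_of_snd _ _ _ _ _ _
  · by_cases h2 : x.2.2 = 0
    · have ho : ∀ᶠ q in 𝓝 x, inside true q = inside true x := eventually_inside hx h2
      filter_upwards [ho, eventually_quad_fst h1, (eventually_quad_fst h1).eventually_nhds]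
        with y hy hy' hyy
      filter_upwards [hyy] with q hq
      simp only [transport, hy]
      rw [← Prod.mk.eta (p := quad q.2), ← Prod.mk.eta (p := quad y.2),
        ← Prod.mk.eta (p := quad x.2), hq, hy', tr_snd_irrel _ (inside false y) (inside false x)]
      exact tr_mul_of_fst _ _ _ _ _ _
    · have h := (eventually_quad_fst h1).and (eventually_quad_snd h2)
      filter_upwards [h, h.eventually_nhds] with y hy hyy
      filter_upwards [hyy] with q hq
      have e1 : quad y.2 = quad x.2 := Prod.ext hy.1 hy.2
      have e2 : quad q.2 = quad x.2 := Prod.ext hq.1 hq.2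
      simp only [transport, e1, e2, tr_self, mul_one]

lemma eventually_nu_eq {x : Tor k} (hx : x ∉ solid k) : ∀ᶠ q : Tor k in 𝓝 x,
    nu (quad q.2) (quad x.2) = nu ((quad q.2).1, (quad x.2).2) (quad x.2) := by
  by_cases h2 : x.2.2 = 0
  · have h1 : x.2.1 ≠ 0 := fun h1 => hx (mem_solid.2 (by simp [h1, h2]))
    filter_upwards [eventually_quad_fst h1] with q hq
    rw [← Prod.mk.eta (p := quad q.2), ← Prod.mk.eta (p := quad x.2), hq, nu_of_fst, nu_of_fst]
  · filter_upwards [eventually_quad_snd h2] with q hq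
    rw [← hq]

lemma eventually_transport_link (j : Idx k) {x : Tor k} (hx : x ∉ solid k) :
    ∀ᶠ q in 𝓝 x, transport (link j q) (link j x) =
      gauge j.1.2 (quad (link j q).2) * nu (quad q.2) (quad x.2) *
        (gauge j.1.2 (quad (link j x).2))⁻¹ := by
  have hnu := eventually_nu_eq hx
  have hcont : ContinuousAt (link j) x := (continuous_link j).continuousAt
  have hd := inside_link j x
  have hmix : ∀ s, s = (pack j.1.2 (link j x).2).1 → s = 0 → inside (!j.1.2) (link j x) = true :=
    fun s hs h0 => inside_not_link j (hs ▸ h0)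
  obtain ⟨sx, hsx⟩ := quad_link j x
  obtain ⟨⟨ω, b⟩, hj⟩ := j
  cases b
  · have key : inside true (link ⟨(ω, false), hj⟩ x) = true ∨
        ∀ᶠ q in 𝓝 x, (quad (link ⟨(ω, false), hj⟩ q).2).2 = (quad (link ⟨(ω, false), hj⟩ x).2).2 := by
      by_cases h : (link ⟨(ω, false), hj⟩ x).2.2 = 0
      · exact Or.inl (hmix _ rfl h)
      · exact Or.inr (hcont.eventually (eventually_quad_snd h))
    have hkey : ∀ᶠ q in 𝓝 x, transport (link ⟨(ω, false), hj⟩ q) (link ⟨(ω, false), hj⟩ x) =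
        tr true (!(quad x.2).2) (quad (link ⟨(ω, false), hj⟩ q).2)
          (quad (link ⟨(ω, false), hj⟩ x).2) := by
      rcases key with h | h
      · exact .of_forall fun q => by rw [transport, h, hd]
      · filter_upwards [h] with q hq
        rw [transport, hd, ← Prod.mk.eta (p := quad (link _ q).2), hq,
          ← Prod.mk.eta (p := quad (link _ x).2), tr_fst_irrel]
    filter_upwards [hkey, hnu] with q hq hnq
    obtain ⟨sq, hsq⟩ := quad_link ⟨(ω, false), hj⟩ q
    rw [hq, hnq, hsq, hsx]
    exact tr_odd _ _ _ _ _
  · have key : inside false (link ⟨(ω, true), hj⟩ x) = true ∨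
        ∀ᶠ q in 𝓝 x, (quad (link ⟨(ω, true), hj⟩ q).2).1 = (quad (link ⟨(ω, true), hj⟩ x).2).1 := by
      by_cases h : (link ⟨(ω, true), hj⟩ x).2.1 = 0
      · exact Or.inl (hmix _ rfl h)
      · exact Or.inr (hcont.eventually (eventually_quad_fst h))
    have hkey : ∀ᶠ q in 𝓝 x, transport (link ⟨(ω, true), hj⟩ q) (link ⟨(ω, true), hj⟩ x) =
        tr (!(quad x.2).2) true (quad (link ⟨(ω, true), hj⟩ q).2)
          (quad (link ⟨(ω, true), hj⟩ x).2) := by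
      rcases key with h | h
      · exact .of_forall fun q => by rw [transport, h, hd]
      · filter_upwards [h] with q hq
        rw [transport, hd, ← Prod.mk.eta (p := quad (link _ q).2), hq,
          ← Prod.mk.eta (p := quad (link _ x).2), tr_snd_irrel]
    filter_upwards [hkey, hnu] with q hq hnq
    obtain ⟨sq, hsq⟩ := quad_link ⟨(ω, true), hj⟩ q
    rw [hq, hnq, hsq, hsx]
    exact tr_even _ _ _ _ _

lemma inside_eq_false {b : Bool} {p : Tor k} (hp : 1 < |(pack b p.2).1|) : inside b p = false := by
  rw [inside, decide_eq_false_iff_not, not_lt, gau, splitLast_snd_snd]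
  have := one_lt_sq_iff_one_lt_abs _ |>.2 hp
  nlinarith [sq_nonneg (ang (len k) b (splitLast k p).2.1)]

lemma eventually_transport_eq_nu {x : Tor k} (hx : x ∉ solid k) :
    ∀ᶠ q in 𝓝 x, transport q x = nu (quad q.2) (quad x.2) := by
  have htr : ∀ q x, nu q x = tr false false q x := fun _ _ => rfl
  rw [mem_solid, not_and_or, not_le, not_le] at hx
  rcases hx with hx | hx
  · have h : x.2.1 ≠ 0 := fun h => by norm_num [h] at hx
    have hi : inside true x = false := inside_eq_false hx
    filter_upwards [eventually_quad_fst h] with q hq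
    rw [transport, hi, htr, ← Prod.mk.eta (p := quad q.2), ← Prod.mk.eta (p := quad x.2), hq]
    exact tr_snd_irrel _ _ _ _ _ _
  · have h : x.2.2 ≠ 0 := fun h => by norm_num [h] at hx
    have hi : inside false x = false := inside_eq_false hx
    filter_upwards [eventually_quad_snd h] with q hq
    rw [transport, hi, htr, ← Prod.mk.eta (p := quad q.2), ← Prod.mk.eta (p := quad x.2), hq]
    exact tr_fst_irrel _ _ _ _ _ _

/-- The gluing defining the local system on the complement of the necklace. -/
def gluing (k : ℕ) : Gluing (Tor k) (Tor k) (Idx k) Gp where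
  V := solid k
  e := link
  ν q x := nu (quad q.2) (quad x.2)
  t := transport
  c j x := gauge j.1.2 (quad x.2)
  isOpenEmbedding := isOpenEmbedding_link
  disjoint := link_disjoint
  isClosed := isClosed_iUnion_of_finite fun j =>
    (isCompact_solid.image (continuous_link j)).isClosed
  trans _ := eventually_transport
  star j _ := eventually_transport_link j

lemma iInter_stage_gluing : ⋂ m, (gluing k).stage m = (necklace k).attractor := by
  refine iInter_congr fun m => ?_
  induction m with
  | zero => rfl
  | succ m ih =>
    show ⋃ j, link j '' (gluing k).stage m = ∅ ∪ ⋃ j, link j '' (necklace k).stage m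
    rw [ih, empty_union]

end Local

section Wild

open Quadrant

variable {k n : ℕ}

lemma eq_of_nu_eq_one {ψ : ℝ × ℝ → Gp}
    (h : ∀ v : ℝ × ℝ, 1 < |v.1| ∨ 1 < |v.2| → ∀ᶠ w in 𝓝 v, ψ w = nu (quad w) (quad v) * ψ v)
    {S : Set (ℝ × ℝ)} (hS : Convex ℝ S) (h1 : ∀ v ∈ S, 1 < |v.1| ∨ 1 < |v.2|)
    (h2 : ∀ v ∈ S, ∀ w ∈ S, nu (quad w) (quad v) = 1) {v w : ℝ × ℝ} (hv : v ∈ S) (hw : w ∈ S) :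
    ψ v = ψ w := by
  refine hS.isPreconnected.eq_of_eventually_eq (fun x hx => ?_) hv hw
  filter_upwards [(h x (h1 x hx)).filter_mono nhdsWithin_le_nhds, self_mem_nhdsWithin] with q hq hqS
  rw [hq, h2 x hx q hqS, one_mul]

/-- The local system with transport `nu` has nontrivial monodromy around the square. -/
lemma nu_not_trivial {ψ : ℝ × ℝ → Gp}
    (h : ∀ v : ℝ × ℝ, 1 < |v.1| ∨ 1 < |v.2| → ∀ᶠ w in 𝓝 v, ψ w = nu (quad w) (quad v) * ψ v) :
    False := by
  have hconv : ∀ s t : Set ℝ, Convex ℝ s → Convex ℝ t → Convex ℝ (s ×ˢ t) :=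
    fun s t hs ht => hs.prod ht
  have hgt : ∀ x : ℝ, 2 ≤ x → 1 < |x| := fun x hx => lt_abs.2 (Or.inl (by linarith))
  have hlt : ∀ x : ℝ, x ≤ -2 → 1 < |x| := fun x hx => lt_abs.2 (Or.inr (by linarith))
  have hfst : ∀ (b : Bool) (S : Set (ℝ × ℝ)), (∀ v ∈ S, (quad v).1 = b) →
      ∀ v ∈ S, ∀ w ∈ S, nu (quad w) (quad v) = 1 := fun b S hb v hv w hw => by
    rw [← Prod.mk.eta (p := quad w), ← Prod.mk.eta (p := quad v), hb v hv, hb w hw, nu_of_fst]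
  have e1 : ψ (2, 2) = ψ (-2, 2) := by
    refine eq_of_nu_eq_one h (hconv univ (Ici 2) convex_univ (convex_Ici _))
      (fun v hv => Or.inr (hgt _ hv.2)) (fun v hv w hw => ?_) (by simp) (by simp)
    have : (quad w).2 = true := decide_eq_true (zero_le_two.trans hw.2)
    rw [← Prod.mk.eta (p := quad w), ← Prod.mk.eta (p := quad v), this, nu_of_snd_true]
  have e2 : ψ (2, 2) = ψ (2, -2) :=
    eq_of_nu_eq_one h (hconv (Ici 2) univ (convex_Ici _) convex_univ)
      (fun v hv => Or.inl (hgt _ hv.1))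
      (hfst true _ fun v hv => decide_eq_true (zero_le_two.trans hv.1)) (by simp) (by simp)
  have e3 : ψ (-2, 2) = ψ (-2, -2) :=
    eq_of_nu_eq_one h (hconv (Iic (-2)) univ (convex_Iic _) convex_univ)
      (fun v hv => Or.inl (hlt _ hv.1))
      (hfst false _ fun v hv => decide_eq_false (not_le.2 (lt_of_le_of_lt hv.1 (by norm_num))))
      (by simp) (by simp)
  have e4 : ψ (2, -2) = ψ (0, -2) :=
    eq_of_nu_eq_one h (hconv (Ici 0) (Iic (-2)) (convex_Ici _) (convex_Iic _))
      (fun v hv => Or.inr (hlt _ hv.2)) (hfst true _ fun v hv => decide_eq_true hv.1)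
      (by simp) (by simp)
  have e5 : ∀ x < 0, ψ (-2, -2) = ψ (x, -2) := fun x hx =>
    eq_of_nu_eq_one h (hconv (Iio 0) (Iic (-2)) (convex_Iio _) (convex_Iic _))
      (fun v hv => Or.inr (hlt _ hv.2)) (hfst false _ fun v hv => decide_eq_false (not_le.2 hv.1))
      (by simp) (by simpa using hx)
  have hmap : Filter.Tendsto (fun x : ℝ => (x, (-2 : ℝ))) (𝓝[<] 0) (𝓝 (0, -2)) :=
    ((by fun_prop : Continuous fun x : ℝ => (x, (-2 : ℝ))).tendsto 0).mono_left nhdsWithin_le_nhds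
  obtain ⟨x, hx, hx0⟩ := ((hmap.eventually (h (0, -2) (Or.inr (hlt _ le_rfl)))).and
    self_mem_nhdsWithin).exists
  have hx0 : x < 0 := hx0
  have hq : quad (x, -2) = (false, false) := by simp [quad, hx0]
  have hq0 : quad (0, -2) = (true, false) := by simp [quad]
  rw [hq, hq0, ← e5 x hx0, ← e3, ← e1, ← e4, ← e2, eq_comm, mul_eq_right] at hx
  exact gc_ne_one (inv_eq_one.1 hx)

/-- The transport across the spanning annuli of the even tubes. -/
def zeta (y : Bool) : Gp := if y then 1 else ga

lemma he_conj_nu (y y' z : Bool) : he * nu (y, z) (y', z) * he⁻¹ =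
    if z then 1 else zeta y * (zeta y')⁻¹ := by
  revert y y' z; decide +kernel

/-- A thickened union of the spanning annuli of the even tubes. -/
def collar (k : ℕ) : Set (Tor k) := {p | inside true p = true ∧ |p.2.2| ≤ 1}

lemma isCompact_closure_collar : IsCompact (closure (collar k)) := by
  have h : collar k ⊆ solid k := fun p ⟨h1, h2⟩ => by
    refine mem_solid.2 ⟨?_, h2⟩
    by_contra! h3
    rw [inside_eq_false (b := true) h3] at h1
    cases h1
  exact isCompact_solid.of_isClosed_subset isClosed_closure
    (closure_minimal h isCompact_solid.isClosed)

lemma link_mem_collar_iff {j : Idx k} (hj : j.1.2 = true) {p : Tor k} :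
    link j p ∈ collar k ↔ (quad p.2).2 = false := by
  have h := inside_link j p
  rw [hj] at h
  simp [collar, h, (abs_link_le j p).2]

variable {E : Type*} {F : Tor k → E}

open Classical in
/-- The transport in the ambient space: it is nontrivial only across the even annuli. -/
def ambientTransport (F : Tor k → E) (q x : E) : Gp :=
  if x ∈ F '' collar k then
    zeta (quad (Function.invFun F q).2).2 * (zeta (quad (Function.invFun F x).2).2)⁻¹
  else 1

lemma ambientTransport_apply (hF : Function.Injective F) (q x : Tor k) [Decidable (x ∈ collar k)] :
    ambientTransport F (F q) (F x) =
      if x ∈ collar k then zeta (quad q.2).2 * (zeta (quad x.2).2)⁻¹ else 1 := by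
  simp only [ambientTransport, hF.mem_set_image, Function.leftInverse_invFun hF _]

lemma ambientTransport_link (hF : Function.Injective F) {j : Idx k} (hj : j.1.2 = true)
    {x : Tor k} (hx : x ∉ solid k) :
    ∀ᶠ q in 𝓝 x, ambientTransport F (F (link j q)) (F (link j x)) =
      he * nu (quad q.2) (quad x.2) * he⁻¹ := by
  classical
  have h : ∀ p, (quad (link j p).2).2 = (quad p.2).1 := fun p => by
    obtain ⟨s, hs⟩ := quad_link j p
    rw [hs, if_pos hj]
  filter_upwards [eventually_nu_eq hx] with q hq
  rw [ambientTransport_apply hF, hq, ← Prod.mk.eta (p := quad x.2), he_conj_nu, h, h]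
  simp only [link_mem_collar_iff hj]
  cases (quad x.2).2 <;> simp

variable [TopologicalSpace E]

lemma eventually_ambientTransport [T2Space E] (hF : IsOpenEmbedding F) {x : E}
    (hx : x ∉ ⋃ j : {j : Idx k // j.1.2 = true}, (F ∘ link j.1) '' solid k) :
    ∀ᶠ y in 𝓝 x, ∀ᶠ q in 𝓝 y,
      ambientTransport F q x = ambientTransport F q y * ambientTransport F y x := by
  classical
  by_cases hxc : x ∈ F '' closure (collar k)
  · obtain ⟨p, hp, rfl⟩ := hxc
    rw [← hF.map_nhds_eq, Filter.eventually_map]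
    simp only [← hF.map_nhds_eq, Filter.eventually_map, ambientTransport_apply hF.injective]
    by_cases h2 : p.2.2 = 0
    · have hc : ∀ᶠ y in 𝓝 p, y ∈ collar k := by
        have h3 : gau (len k) true (splitLast k p).2 ≠ (5 / 2) ^ 2 := fun h3 => by
          obtain ⟨ω, u, hω, hu⟩ := exists_of_gau_eq (len_pos k) h3 h2
          refine hx (mem_iUnion.2 ⟨⟨⟨(ω, true), hω⟩, rfl⟩,
            (splitHead k).symm ((splitLast k p).1, u, 0, 0), ?_, congrArg F ?_⟩)
          · rw [mem_solid]; simp [splitHead]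
          · rw [← (splitLast k).injective.eq_iff, splitLast_link, Homeomorph.apply_symm_apply]
            exact Prod.ext rfl hu.symm
        have h4 : gau (len k) true (splitLast k p).2 ≤ (5 / 2) ^ 2 :=
          closure_minimal (fun q hq => (of_decide_eq_true hq.1).le)
            (isClosed_le (continuous_gau_splitLast true) continuous_const) hp
        have h5 : ∀ᶠ y : Tor k in 𝓝 p, |y.2.2| < 1 :=
          (by fun_prop : Continuous fun y : Tor k => |y.2.2|).continuousAt.eventually_lt
            continuousAt_const (by simp [h2])
        filter_upwards [(continuous_gau_splitLast true).continuousAt.eventually_lt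
          continuousAt_const (lt_of_le_of_ne h4 h3), h5] with y hy hy'
        exact ⟨decide_eq_true hy, hy'.le⟩
      filter_upwards [hc] with y hy
      refine .of_forall fun q => ?_
      rw [if_pos hc.self_of_nhds, if_pos hc.self_of_nhds, if_pos hy]
      group
    · have h := eventually_quad_snd h2
      filter_upwards [h, h.eventually_nhds] with y hy hyy
      filter_upwards [hyy] with q hq
      simp only [hy, hq, mul_inv_cancel, ite_self, mul_one]
  · have hcl : IsClosed (F '' closure (collar k)) :=
      (isCompact_closure_collar.image hF.continuous).isClosed
    filter_upwards [hcl.isOpen_compl.mem_nhds hxc] with y hy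
    have h : ∀ z ∉ F '' closure (collar k), ∀ q, ambientTransport F q z = 1 := fun z hz q =>
      if_neg fun h => hz (image_mono subset_closure h)
    refine .of_forall fun q => ?_
    rw [h x hxc, h y hy, h x hxc, one_mul]

/-- The gluing defining the local system on the complement of an embedded necklace. -/
def ambientGluing [T2Space E] (hF : IsOpenEmbedding F) :
    Gluing (Tor k) E {j : Idx k // j.1.2 = true} Gp where
  V := solid k
  e j := F ∘ link j.1
  ν q x := nu (quad q.2) (quad x.2)
  t := ambientTransport F
  c _ _ := he
  isOpenEmbedding j := hF.comp (isOpenEmbedding_link j.1)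
  disjoint _ _ _ _ h := Subtype.ext (link_disjoint _ _ _ _ (hF.injective h))
  isClosed := isClosed_iUnion_of_finite fun j =>
    (isCompact_solid.image (hF.continuous.comp (continuous_link j.1))).isClosed
  trans _ := eventually_ambientTransport hF
  star j _ := ambientTransport_link hF.injective j.2

/-- An embedded necklace is wild. -/
theorem not_tameSet_image_necklace (hn : 3 ≤ n) {F : Tor k → EuclideanSpace ℝ (Fin n)}
    (hF : IsOpenEmbedding F) : ¬TameSet (F '' (necklace k).attractor) := by
  rintro ⟨h, hh⟩
  let D := ambientGluing hF
  let P := ⋃ j : {j : Idx k // j.1.2 = true}, (F ∘ link j.1) '' (necklace k).attractor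
  have hP : IsCompact P := isCompact_iUnion fun j =>
    (necklace k).isCompact_attractor.image (hF.continuous.comp (continuous_link j.1))
  have hPt : TameSet P := ⟨h, (image_mono (iUnion_subset fun j => by
    rw [image_comp]
    refine image_mono ?_
    rintro _ ⟨x, hx, rfl⟩
    exact (necklace k).map_attractor hx)).trans hh⟩
  have hV : ∀ j x, (gluing k).e j x ∈ (gluing k).V := link_mem_solid
  have hν : ∀ x ∉ (gluing k).V, ∀ᶠ q in 𝓝 x, (gluing k).t q x = (gluing k).ν q x :=
    fun x => eventually_transport_eq_nu
  have hO : OuterLaw D.V D.ν (gluing k).limit := (gluing k).limit_outerLaw hV hν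
  have hflat : IsFlat (D.Paste (gluing k).limit) :=
    Gluing.paste_isFlat ((gluing k).limit_isFlat hV hν) hO
  obtain ⟨f, hf⟩ := hflat.exists_global_of_tameSet hn hP hPt fun x hx => by
    by_cases hxV : x ∈ ⋃ j, D.e j '' D.V
    · obtain ⟨j, p, -, rfl⟩ := mem_iUnion.1 hxV
      obtain ⟨s, hs⟩ := (gluing k).limit_exists hV (x := p) fun hp => by
        rw [iInter_stage_gluing] at hp
        exact hx (mem_iUnion.2 ⟨j, p, hp, rfl⟩)
      exact Gluing.paste_exists_of_flat hs
    · exact Gluing.paste_exists_of_notMem hxV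
  obtain ⟨j, hj⟩ := exists_idx k true
  let i : {j : Idx k // j.1.2 = true} := ⟨j, hj⟩
  have hφ : ∀ x ∉ solid k, ∀ᶠ q : Tor k in 𝓝 x,
      he⁻¹ * f (D.e i q) = nu (quad q.2) (quad x.2) * (he⁻¹ * f (D.e i x)) := fun x hx => by
    obtain ⟨s, hs⟩ := (gluing k).limit_exists hV (x := x) fun hp => by
      rw [iInter_stage_gluing] at hp
      exact hx ((necklace k).attractor_subset hp)
    obtain ⟨s, hs⟩ := Gluing.paste_exists_of_flat (D := D) (j := i) hs
    have hxP : D.e i x ∉ P := fun hxP => by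
      obtain ⟨j', p, hp, hpx⟩ := mem_iUnion.1 hxP
      obtain rfl := D.disjoint j' i _ _ hpx
      obtain rfl := (D.isOpenEmbedding _).injective hpx
      exact hx ((necklace k).attractor_subset hp)
    obtain ⟨c, hc⟩ := hf _ hxP s hs
    have hc' : ∀ᶠ q in 𝓝 x, f (D.e i q) = s (D.e i q) * c := Gluing.eventually_map.1 hc
    filter_upwards [hc', Gluing.Paste.outer hO hx hs] with q hq hq'
    rw [hq, hq', hc'.self_of_nhds]
    show he⁻¹ * (he * nu (quad q.2) (quad x.2) * he⁻¹ * s (D.e i x) * c) = _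
    group
  refine nu_not_trivial (ψ := fun v => he⁻¹ * f (D.e i (fun _ => 1, v))) fun v hv => ?_
  have hv' : ((fun _ => 1, v) : Tor k) ∉ solid k := fun h => by
    rw [mem_solid] at h
    rcases hv with hv | hv
    exacts [h.1.not_gt hv, h.2.not_gt hv]
  exact ((by fun_prop : Continuous fun v : ℝ × ℝ => ((fun _ => 1, v) : Tor k)).tendsto v).eventually
    (hφ _ hv')

end Wild

section OpenEmbedding

/-- The product of an `m`-dimensional torus with a plane embeds in a space of dimension `m + 2`. -/
lemma exists_isOpenEmbedding_torus (m : ℕ) :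
    ∃ g : (Fin m → Circle) × ℝ × ℝ → EuclideanSpace ℝ (Fin (m + 2)), IsOpenEmbedding g := by
  induction m with
  | zero =>
    let L : (ℝ × ℝ) ≃L[ℝ] EuclideanSpace ℝ (Fin (0 + 2)) := .ofFinrankEq (by simp)
    exact ⟨_, (L.toHomeomorph.isOpenEmbedding).comp
      (Homeomorph.uniqueProd (Fin 0 → Circle) (ℝ × ℝ)).isOpenEmbedding⟩
  | succ m ih =>
    obtain ⟨g, hg⟩ := ih
    let L : EuclideanSpace ℝ (Fin (m + 2)) ≃L[ℝ] ℝ × EuclideanSpace ℝ (Fin (m + 1)) :=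
      .ofFinrankEq (by simp; omega)
    let L' : (ℂ × EuclideanSpace ℝ (Fin (m + 1))) ≃L[ℝ] EuclideanSpace ℝ (Fin (m + 1 + 2)) :=
      .ofFinrankEq (by simp; omega)
    let e : Tor m ≃ₜ Circle × (Fin m → Circle) × ℝ × ℝ := (splitHead m).trans
      ((Homeomorph.prodAssoc _ _ _).symm.trans
        (((Homeomorph.prodComm _ _).prodCongr (Homeomorph.refl _)).trans
          (Homeomorph.prodAssoc _ _ _)))
    exact ⟨_, L'.toHomeomorph.isOpenEmbedding.comp
      ((isOpenEmbedding_polar.prodMap IsOpenEmbedding.id).comp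
        ((Homeomorph.prodAssoc _ _ _).symm.isOpenEmbedding.comp
          ((IsOpenEmbedding.id.prodMap (L.toHomeomorph.isOpenEmbedding.comp hg)).comp
            e.isOpenEmbedding)))⟩

lemma exists_isOpenEmbedding_tor (k : ℕ) {r : ℝ} (hr : 0 < r) :
    ∃ F : Tor k → EuclideanSpace ℝ (Fin (k + 3)), IsOpenEmbedding F ∧
      F '' (necklace k).attractor ⊆ ball 0 r := by
  obtain ⟨g, hg⟩ := exists_isOpenEmbedding_torus (k + 1)
  obtain ⟨R, hR, hgR⟩ := ((necklace k).isCompact_attractor.image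
    hg.continuous).isBounded.subset_ball_lt 0 0
  have hrR : r / R ≠ 0 := (div_pos hr hR).ne'
  refine ⟨_, (Homeomorph.smulOfNeZero (r / R) hrR).isOpenEmbedding.comp hg, ?_⟩
  rintro _ ⟨x, hx, rfl⟩
  have := hgR (mem_image_of_mem g hx)
  rw [mem_ball_zero_iff] at this
  show (r / R) • g x ∈ _
  rw [mem_ball_zero_iff, norm_smul, Real.norm_of_nonneg (div_pos hr hR).le]
  calc r / R * ‖g x‖ < r / R * R := by gcongr
    _ = r := div_mul_cancel₀ _ hR.ne'

end OpenEmbedding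

section CantorSets

/-- A set without isolated points. -/
def NoIsolated {X : Type*} [TopologicalSpace X] (K : Set X) : Prop :=
  ∀ x ∈ K, ∀ U ∈ 𝓝 x, ∃ y ∈ K, y ∈ U ∧ y ≠ x

lemma NoIsolated.image {X Y : Type*} [TopologicalSpace X] [TopologicalSpace Y] {K : Set X}
    (hK : NoIsolated K) {f : X → Y} (hf : Continuous f) (hi : Function.Injective f) :
    NoIsolated (f '' K) := by
  rintro _ ⟨x, hx, rfl⟩ U hU
  obtain ⟨y, hy, hyU, hne⟩ := hK x hx _ (hf.continuousAt hU)
  exact ⟨f y, mem_image_of_mem f hy, hyU, hi.ne hne⟩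

lemma NoIsolated.union {X : Type*} [TopologicalSpace X] {K L : Set X} (hK : NoIsolated K)
    (hL : NoIsolated L) : NoIsolated (K ∪ L) := by
  rintro x (hx | hx) U hU
  · obtain ⟨y, hy, h⟩ := hK x hx U hU
    exact ⟨y, Or.inl hy, h⟩
  · obtain ⟨y, hy, h⟩ := hL x hx U hU
    exact ⟨y, Or.inr hy, h⟩

lemma isCantorSet_of_noIsolated {X : Type*} [MetricSpace X] {K : Set X} (hc : IsCompact K)
    (ht : IsTotallyDisconnected K) (hne : K.Nonempty) (hp : NoIsolated K) : IsCantorSet K := by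
  have : CompactSpace K := isCompact_iff_compactSpace.1 hc
  have : Nonempty K := hne.to_subtype
  have : TotallyDisconnectedSpace K := totallyDisconnectedSpace_subtype_iff.2 ht
  obtain ⟨h⟩ := nonempty_homeomorph_natBool_of_perfect (X := K) fun x hx => by
    obtain ⟨U, hU, hUx⟩ := isOpen_induced_iff.1 hx
    have hxU : (x : X) ∈ U := by
      have : x ∈ Subtype.val ⁻¹' U := hUx ▸ mem_singleton x
      exact this
    obtain ⟨y, hy, hyU, hne⟩ := hp x x.2 U (hU.mem_nhds hxU)
    have : (⟨y, hy⟩ : K) ∈ ({x} : Set K) := hUx ▸ hyU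
    exact hne (congrArg Subtype.val this)
  exact ⟨h.trans cantorSetHomeomorphNatToBool.symm⟩

lemma isOpenEmbedding_foldr {X J : Type*} [TopologicalSpace X] {f : J → X → X}
    (hf : ∀ j, IsOpenEmbedding (f j)) (w : List J) : IsOpenEmbedding fun x => w.foldr f x := by
  induction w with
  | nil => exact IsOpenEmbedding.id
  | cons j w ih => exact (hf j).comp ih

end CantorSets

section Pair

variable {E : Type*} [NormedAddCommGroup E] [NormedSpace ℝ E]

/-- The two contracting similarities with centres on the line spanned by `e`. -/
def simil (e : E) (b : Bool) : E ≃ₜ E :=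
  (Homeomorph.smulOfNeZero (1 / 8 : ℝ) (by norm_num)).trans
    (Homeomorph.addRight (if b then (1 / 2 : ℝ) • e else -((1 / 2 : ℝ) • e)))

lemma simil_apply (e : E) (b : Bool) (x : E) :
    simil e b x = (1 / 8 : ℝ) • x + if b then (1 / 2 : ℝ) • e else -((1 / 2 : ℝ) • e) := rfl

lemma dist_simil (e : E) (b : Bool) (x y : E) : dist (simil e b x) (simil e b y) = dist x y / 8 := by
  rw [simil_apply, simil_apply, dist_add_right, dist_smul₀, Real.norm_of_nonneg (by norm_num)]
  ring

lemma dist_foldr_simil (e : E) (w : List Bool) (x y : E) :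
    dist (w.foldr (fun b => simil e b) x) (w.foldr (fun b => simil e b) y) =
      dist x y * (1 / 8) ^ w.length := by
  induction w with
  | nil => simp
  | cons b w ih => rw [List.foldr_cons, List.foldr_cons, dist_simil, ih, List.length_cons]; ring

variable {e : E}

lemma norm_ite (he : ‖e‖ = 1) (b : Bool) :
    ‖if b then (1 / 2 : ℝ) • e else -((1 / 2 : ℝ) • e)‖ = 1 / 2 := by
  cases b <;> simp [norm_smul, he]

lemma norm_simil_le (he : ‖e‖ = 1) (b : Bool) {x : E} (hx : x ∈ closedBall (0 : E) 1) :
    ‖simil e b x‖ ≤ 5 / 8 := by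
  rw [mem_closedBall_zero_iff] at hx
  rw [simil_apply]
  refine (norm_add_le _ _).trans ?_
  rw [norm_ite he, norm_smul, Real.norm_of_nonneg (by norm_num)]
  linarith

lemma le_norm_simil (he : ‖e‖ = 1) (b : Bool) {x : E} (hx : x ∈ closedBall (0 : E) 1) :
    3 / 8 ≤ ‖simil e b x‖ := by
  rw [mem_closedBall_zero_iff] at hx
  have h := norm_sub_le (simil e b x) ((1 / 8 : ℝ) • x)
  rw [simil_apply, add_sub_cancel_left, norm_ite he, norm_smul,
    Real.norm_of_nonneg (by norm_num)] at h
  rw [simil_apply]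
  linarith

lemma simil_true_mem_ball {x : E} (hx : x ∈ closedBall (0 : E) 1) :
    simil e true x ∈ ball ((1 / 2 : ℝ) • e) (1 / 4) := by
  rw [mem_closedBall_zero_iff] at hx
  rw [mem_ball_iff_norm, simil_apply, if_pos rfl, add_sub_cancel_right, norm_smul,
    Real.norm_of_nonneg (by norm_num)]
  linarith

lemma simil_false_notMem_ball (he : ‖e‖ = 1) {x : E} (hx : x ∈ closedBall (0 : E) 1) :
    simil e false x ∉ ball ((1 / 2 : ℝ) • e) (1 / 4) := by
  rw [mem_closedBall_zero_iff] at hx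
  rw [mem_ball_iff_norm, not_lt]
  have h1 : simil e false x - (1 / 2 : ℝ) • e = (1 / 8 : ℝ) • x - e := by
    rw [simil_apply, if_neg (by simp)]; module
  have h2 := norm_sub_norm_le e ((1 / 8 : ℝ) • x)
  rw [norm_sub_rev, he, norm_smul, Real.norm_of_nonneg (by norm_num)] at h2
  rw [h1]
  linarith

lemma simil_disjoint (he : ‖e‖ = 1) {i j : Bool} {x y : E} (hx : x ∈ closedBall (0 : E) 1)
    (hy : y ∈ closedBall (0 : E) 1) (h : simil e i x = simil e j y) : i = j := by
  cases i <;> cases j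
  · rfl
  · exact absurd (h ▸ simil_true_mem_ball hy) (simil_false_notMem_ball he hx)
  · exact absurd (h ▸ simil_true_mem_ball hx) (simil_false_notMem_ball he hy)
  · rfl

/-- The iterated function system of the two similarities, with condensation set `C`. -/
def pairIFS (he : ‖e‖ = 1) {B C : Set E} (hB : IsCompact B) (hB1 : B ⊆ closedBall 0 1)
    (hm : ∀ b, MapsTo (simil e b) B B) (hC : IsCompact C) (hCB : C ⊆ B)
    (hC1 : C ⊆ ball 0 (1 / 8)) : CondensedIFS E Bool where
  f b := simil e b
  B := B
  C := C
  continuous b := (simil e b).continuous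
  injective b := (simil e b).injective
  isCompact := hB
  isCompact_C := hC
  mapsTo := hm
  subset := hCB
  disjoint _ _ _ hx _ hy h := simil_disjoint he (hB1 hx) (hB1 hy) h
  disjoint_C b x hx h := by
    have h1 := le_norm_simil he b (hB1 hx)
    have h2 := mem_ball_zero_iff.1 (hC1 h)
    linarith
  shrink ε hε := by
    obtain ⟨m, hm⟩ := exists_pow_lt_of_lt_one (half_pos hε) (by norm_num : (1 / 8 : ℝ) < 1)
    refine ⟨m, fun w hw x hx y hy => ?_⟩
    have h : dist x y ≤ 2 := by
      have h1 := mem_closedBall.1 (hB1 hx)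
      have h2 := mem_closedBall.1 (hB1 hy)
      linarith [dist_triangle_right x y 0]
    rw [dist_foldr_simil, hw]
    have : (0 : ℝ) < (1 / 8) ^ m := by positivity
    nlinarith

end Pair

section Construction

variable {n k : ℕ}

local notation "𝔼" => EuclideanSpace ℝ (Fin n)

/-- In the attractor of the pair system condensed to an embedded necklace, every neighbourhood of
a point contains an embedded necklace. -/
lemma exists_necklace_subset {e : 𝔼} (S : CondensedIFS 𝔼 Bool)
    (hS : ∀ b, S.f b = simil e b) {F : Tor k → 𝔼} (hF : IsOpenEmbedding F)
    (hC : S.C = F '' (necklace k).attractor) {x : 𝔼} (hx : x ∈ S.attractor) {U : Set 𝔼}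
    (hU : U ∈ 𝓝 x) :
    ∃ H : Tor k → 𝔼, IsOpenEmbedding H ∧ H '' (necklace k).attractor ⊆ S.attractor ∩ U := by
  have hw : ∀ w : List Bool, IsOpenEmbedding fun x => w.foldr S.f x :=
    isOpenEmbedding_foldr fun j => by rw [hS]; exact (simil e j).isOpenEmbedding
  have hFS : ∀ p ∈ (necklace k).attractor, F p ∈ S.attractor := fun p hp =>
    S.C_subset_attractor (hC ▸ mem_image_of_mem F hp)
  rcases S.exists_copy hx with ⟨w, y, hy, rfl⟩ | h
  · rw [hC] at hy
    obtain ⟨p, hp, rfl⟩ := hy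
    have hcomp := (hw w).comp hF
    rcases (necklace k).exists_copy hp with ⟨-, y, hy, -⟩ | h
    · cases hy
    · obtain ⟨w', -, hw'⟩ := h _ (hcomp.continuous.continuousAt hU)
      refine ⟨_, hcomp.comp (isOpenEmbedding_foldr isOpenEmbedding_link w'), ?_⟩
      rintro _ ⟨z, hz, rfl⟩
      exact ⟨S.foldr_attractor w (hFS _ ((necklace k).foldr_attractor w' hz)), hw' z hz⟩
  · obtain ⟨w, -, h⟩ := h U hU
    refine ⟨_, (hw w).comp hF, ?_⟩
    rintro _ ⟨z, hz, rfl⟩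
    exact ⟨S.foldr_attractor w (hFS z hz), h _ (hFS z hz)⟩

lemma noIsolated_necklace : NoIsolated (necklace k).attractor :=
  fun _ hx _ hU => (necklace k).attractor_perfect ⟨_, hx⟩ (fun _ h => h.elim) hx hU

lemma isTotallyDisconnected_image_necklace {F : Tor k → 𝔼} (hF : IsOpenEmbedding F) :
    IsTotallyDisconnected (F '' (necklace k).attractor) :=
  hF.isEmbedding.isTotallyDisconnected_image.2
    ((necklace k).isTotallyDisconnected_attractor isTotallyDisconnected_empty)

lemma isClosed_coordLine : IsClosed (coordLine n) := by
  simp only [coordLine, ofPred_forall]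
  exact isClosed_iInter fun i => isClosed_iInter fun _ =>
    isClosed_eq (by fun_prop) continuous_const

lemma simil_mem_coordLine {e : 𝔼} (he : e ∈ coordLine n) (b : Bool) {x : 𝔼}
    (hx : x ∈ coordLine n) : simil e b x ∈ coordLine n := fun i hi => by
  cases b <;> simp [simil_apply, hx i hi, he i hi]

lemma simil_mapsTo {e : 𝔼} (he : ‖e‖ = 1) (b : Bool) :
    MapsTo (simil e b) (closedBall 0 1) (closedBall 0 1) := fun x hx => by
  rw [mem_closedBall_zero_iff]
  linarith [norm_simil_le he b hx]

lemma TameSet.mono {K L : Set 𝔼} (hL : TameSet L) (h : K ⊆ L) : TameSet K :=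
  hL.imp fun _ hg => (image_mono h).trans hg

/-- A set containing embedded necklaces near all of its points is not equivalent to a set with a
nonempty relatively open subset in the coordinate line. -/
lemma not_equivalent (hn : 3 ≤ n) {X Y : Set 𝔼}
    (hY : ∀ x ∈ Y, ∀ U ∈ 𝓝 x, ∃ H : Tor k → 𝔼, IsOpenEmbedding H ∧
      H '' (necklace k).attractor ⊆ Y ∩ U)
    {x : 𝔼} (hx : x ∈ X) {U : Set 𝔼} (hU : U ∈ 𝓝 x) (hXU : X ∩ U ⊆ coordLine n) :
    ¬∃ h : 𝔼 ≃ₜ 𝔼, h '' X = Y := by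
  rintro ⟨h, rfl⟩
  obtain ⟨H, hH, hHU⟩ := hY (h x) (mem_image_of_mem h hx) (h '' U) (h.isOpenMap.image_mem_nhds hU)
  refine not_tameSet_image_necklace hn (h.symm.isOpenEmbedding.comp hH) ⟨.refl _, ?_⟩
  rintro _ ⟨_, ⟨p, hp, rfl⟩, rfl⟩
  obtain ⟨⟨y, hy, hyH⟩, ⟨z, hz, hzH⟩⟩ := hHU (mem_image_of_mem H hp)
  obtain rfl := h.injective (hyH.trans hzH.symm)
  refine hXU ?_
  rw [Homeomorph.refl_apply, Function.comp, ← hyH, h.symm_apply_apply]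
  exact ⟨hy, hz⟩

end Construction

/-- **Remark 2.13 (Frolkina).** For each `n ≥ 3` there are wild Cantor sets `X, Y ⊆ ℝⁿ`
each of which ambiently embeds in the other, yet which are inequivalently embedded. -/
theorem mutually_embeddable_inequivalent_wild_cantor_sets (n : ℕ) (hn : 3 ≤ n) :
    ∃ X Y : Set (EuclideanSpace ℝ (Fin n)),
      IsCantorSet X ∧ IsCantorSet Y ∧ ¬ TameSet X ∧ ¬ TameSet Y ∧
      AmbientlyEmbeds X Y ∧ AmbientlyEmbeds Y X ∧
      ¬ ∃ h : EuclideanSpace ℝ (Fin n) ≃ₜ EuclideanSpace ℝ (Fin n), h '' X = Y := by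
  obtain ⟨k, rfl⟩ := Nat.exists_eq_add_of_le' hn
  obtain ⟨F, hF, hFK⟩ := exists_isOpenEmbedding_tor k (by norm_num : (0 : ℝ) < 1 / 8)
  let e : EuclideanSpace ℝ (Fin (k + 3)) := EuclideanSpace.single 0 1
  have he : ‖e‖ = 1 := by simp [e]
  have hel : e ∈ coordLine (k + 3) := fun i hi => by
    have : i ≠ 0 := fun h => hi (by simp [h])
    simp [e, this]
  let S := pairIFS he (isCompact_closedBall 0 1) subset_rfl (simil_mapsTo he)
    ((necklace k).isCompact_attractor.image hF.continuous)
    (hFK.trans ((ball_subset_ball (by norm_num)).trans ball_subset_closedBall)) hFK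
  let T := pairIFS he ((isCompact_closedBall 0 1).inter_right isClosed_coordLine) inter_subset_left
    (fun b x hx => ⟨simil_mapsTo he b hx.1, simil_mem_coordLine hel b hx.2⟩) isCompact_empty
    (empty_subset _) (empty_subset _)
  have hTS : T.attractor ⊆ S.attractor := iInter_mono fun m => by
    induction m with
    | zero => exact inter_subset_left
    | succ m ih => exact union_subset_union (empty_subset _) (iUnion_mono fun b => image_mono ih)
  have hTl : T.attractor ⊆ coordLine (k + 3) := T.attractor_subset.trans inter_subset_right
  have hTne : T.attractor.Nonempty := T.attractor_nonempty ⟨0, by simp [T, pairIFS, coordLine]⟩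
  have hTp : NoIsolated T.attractor :=
    fun _ hx _ hU => T.attractor_perfect hTne (fun _ h => h.elim) hx hU
  have hWp : NoIsolated (F '' (necklace k).attractor) :=
    noIsolated_necklace.image hF.continuous hF.injective
  have hSne : S.attractor.Nonempty := hTne.mono hTS
  have hSp : NoIsolated S.attractor := fun _ hx _ hU => S.attractor_perfect hSne hWp hx hU
  have hSd : IsTotallyDisconnected S.attractor :=
    S.isTotallyDisconnected_attractor (isTotallyDisconnected_image_necklace hF)
  have hSw : ¬TameSet S.attractor := fun h =>
    not_tameSet_image_necklace hn hF (h.mono S.C_subset_attractor)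
  let X := simil e false '' S.attractor ∪ simil e true '' T.attractor
  have hXS : X ⊆ S.attractor := by
    rintro _ (⟨x, hx, rfl⟩ | ⟨x, hx, rfl⟩)
    exacts [S.map_attractor (j := false) hx, S.map_attractor (j := true) (hTS hx)]
  have hXU : X ∩ ball ((1 / 2 : ℝ) • e) (1 / 4) ⊆ coordLine (k + 3) := by
    rintro _ ⟨⟨x, hx, rfl⟩ | ⟨x, hx, rfl⟩, hxU⟩
    · exact absurd hxU (simil_false_notMem_ball he (S.attractor_subset hx))
    · exact simil_mem_coordLine hel true (hTl hx)
  refine ⟨X, S.attractor, ?_, ?_, ?_, hSw, ⟨.refl _, ?_⟩, ⟨simil e false, subset_union_left⟩, ?_⟩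
  · exact isCantorSet_of_noIsolated
      ((S.isCompact_attractor.image (simil e false).continuous).union
        (T.isCompact_attractor.image (simil e true).continuous))
      (fun t ht => hSd t (ht.trans hXS)) (hSne.image _ |>.mono subset_union_left)
      ((hSp.image (simil e false).continuous (simil e false).injective).union
        (hTp.image (simil e true).continuous (simil e true).injective))
  · exact isCantorSet_of_noIsolated S.isCompact_attractor hSd hSne hSp
  · intro h
    refine not_tameSet_image_necklace hn ((simil e false).isOpenEmbedding.comp hF)
      (h.mono (Subset.trans ?_ subset_union_left))
    rw [image_comp]
    exact image_mono S.C_subset_attractor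
  · exact (image_id X).trans_subset hXS
  · obtain ⟨x, hx⟩ := hTne
    exact not_equivalent hn
      (fun y hy U hU => exists_necklace_subset S (fun _ => rfl) hF rfl hy hU)
      (Or.inr (mem_image_of_mem _ hx))
      (isOpen_ball.mem_nhds (simil_true_mem_ball (T.attractor_subset hx).1)) hXU

end
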